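/- Let h(t) = t·ln(1+t) (the Prandtl–Eyring model). Suppose u ∈ C¹(ℝ², ℝ²) is divergence-free and a weak solution of the stationary generalized Navier–Stokes system with dissipative potential H(ε) = h(|ε|), i.e. ∫_{ℝ²} (h'(|ε(u)|)/|ε(u)|) ε(u) : ε(φ) dx + ∫_{ℝ²} u^k ∂_k u^i φ^i dx = 0 for every divergence-free φ ∈ C_c^∞(ℝ², ℝ²). If sup_{ℝ²} |u| < ∞, then u is a constant vector. -/

import Mathlib

noncomputable section

open MeasureTheory Real Filter

/-- Partial derivative ∂ₖu(x) ∈ ℝⁿ of a vector field u : ℝⁿ → ℝⁿ. -/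
def pd {n : ℕ} (u : EuclideanSpace ℝ (Fin n) → EuclideanSpace ℝ (Fin n))
    (k : Fin n) (x : EuclideanSpace ℝ (Fin n)) : EuclideanSpace ℝ (Fin n) :=
  fderiv ℝ u x (EuclideanSpace.single k 1)

/-- Divergence of u at x. -/
def divg {n : ℕ} (u : EuclideanSpace ℝ (Fin n) → EuclideanSpace ℝ (Fin n))
    (x : EuclideanSpace ℝ (Fin n)) : ℝ :=
  ∑ k, pd u k x k

/-- Symmetric gradient ε(u)(x) = (1/2)(∇u + (∇u)ᵀ), entry (i,j) = (∂ⱼuⁱ + ∂ᵢuʲ)/2. -/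
def symGrad {n : ℕ} (u : EuclideanSpace ℝ (Fin n) → EuclideanSpace ℝ (Fin n))
    (x : EuclideanSpace ℝ (Fin n)) : Matrix (Fin n) (Fin n) ℝ :=
  fun i j => (pd u j x i + pd u i x j) / 2

/-- Full gradient ∇u(x), entry (i,j) = ∂ⱼuⁱ. -/
def gradM {n : ℕ} (u : EuclideanSpace ℝ (Fin n) → EuclideanSpace ℝ (Fin n))
    (x : EuclideanSpace ℝ (Fin n)) : Matrix (Fin n) (Fin n) ℝ :=
  fun i j => pd u j x i

/-- Frobenius inner product A : B. -/
def frob {n : ℕ} (A B : Matrix (Fin n) (Fin n) ℝ) : ℝ := ∑ i, ∑ j, A i j * B i j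

/-- Frobenius norm |A|. -/
def fnorm {n : ℕ} (A : Matrix (Fin n) (Fin n) ℝ) : ℝ := Real.sqrt (frob A A)

/-- DH(ε) = (h'(|ε|)/|ε|) ε, interpreted as 0 at ε = 0. -/
def DH {n : ℕ} (h : ℝ → ℝ) (A : Matrix (Fin n) (Fin n) ℝ) : Matrix (Fin n) (Fin n) ℝ :=
  if fnorm A = 0 then 0 else (deriv h (fnorm A) / fnorm A) • A

/-- u is a weak solution of -div DH(ε(u)) + (u·∇)u + ∇π = 0, div u = 0:
for all smooth compactly supported divergence-free φ,
∫ DH(ε(u)) : ε(φ) dx + ∫ uᵏ ∂ₖuⁱ φⁱ dx = 0. -/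
def IsWeakSolution {n : ℕ} (h : ℝ → ℝ)
    (u : EuclideanSpace ℝ (Fin n) → EuclideanSpace ℝ (Fin n)) : Prop :=
  ∀ φ : EuclideanSpace ℝ (Fin n) → EuclideanSpace ℝ (Fin n),
    ContDiff ℝ (⊤ : ℕ∞) φ → HasCompactSupport φ → (∀ x, divg φ x = 0) →
    (∫ x, frob (DH h (symGrad u x)) (symGrad φ x)) +
      (∫ x, ∑ k, ∑ i, u x k * pd u k x i * φ x i) = 0

/-- u is a weak solution of the Stokes-type system -div DH(ε(u)) + ∇π = 0, div u = 0:
for all smooth compactly supported divergence-free φ, ∫ DH(ε(u)) : ε(φ) dx = 0. -/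
def IsStokesWeakSolution {n : ℕ} (h : ℝ → ℝ)
    (u : EuclideanSpace ℝ (Fin n) → EuclideanSpace ℝ (Fin n)) : Prop :=
  ∀ φ : EuclideanSpace ℝ (Fin n) → EuclideanSpace ℝ (Fin n),
    ContDiff ℝ (⊤ : ℕ∞) φ → HasCompactSupport φ → (∀ x, divg φ x = 0) →
    (∫ x, frob (DH h (symGrad u x)) (symGrad φ x)) = 0

/-- The open square Q_R(x₀) ⊂ ℝ². -/
def sqr (R : ℝ) (x₀ : EuclideanSpace ℝ (Fin 2)) : Set (EuclideanSpace ℝ (Fin 2)) :=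
  {x | |x 0 - x₀ 0| < R ∧ |x 1 - x₀ 1| < R}

/-- h'(t)/t, extended by h''(0) at t = 0. -/
def slopeH (h : ℝ → ℝ) (t : ℝ) : ℝ :=
  if t = 0 then deriv (deriv h) 0 else deriv h t / t

open MeasureTheory Real Filter
/-! ## Basic calculus on the plane -/
namespace LPE
open Topology

/-- The plane. -/
abbrev E2 := EuclideanSpace ℝ (Fin 2)

/-- Standard basis vectors. -/
def ek (k : Fin 2) : E2 := EuclideanSpace.single k 1

/-- Partial derivative of a scalar function. -/
def D (k : Fin 2) (f : E2 → ℝ) (x : E2) : ℝ := fderiv ℝ f x (ek k)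

lemma norm_ek (k : Fin 2) : ‖ek k‖ = 1 := by simp [ek]

lemma D_cont {f : E2 → ℝ} (hf : ContDiff ℝ 1 f) (k : Fin 2) : Continuous (D k f) :=
  (hf.continuous_fderiv one_ne_zero).clm_apply continuous_const

lemma D_contDiff {f : E2 → ℝ} (hf : ContDiff ℝ 2 f) (k : Fin 2) : ContDiff ℝ 1 (D k f) :=
  (hf.fderiv_right (m := 1) (by norm_num)).clm_apply contDiff_const

lemma D_contDiff_top {f : E2 → ℝ} (hf : ContDiff ℝ (⊤ : ℕ∞) f) (k : Fin 2) :
    ContDiff ℝ (⊤ : ℕ∞) (D k f) :=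
  (hf.fderiv_right (m := (⊤ : ℕ∞)) (by simp)).clm_apply contDiff_const

lemma diff_of {f : E2 → ℝ} (hf : ContDiff ℝ 1 f) : Differentiable ℝ f :=
  hf.differentiable one_ne_zero

lemma c1_of_c2 {f : E2 → ℝ} (hf : ContDiff ℝ 2 f) : ContDiff ℝ 1 f := hf.of_le (by norm_num)

lemma D_add {f g : E2 → ℝ} (hf : Differentiable ℝ f) (hg : Differentiable ℝ g) (k : Fin 2) (x : E2) :
    D k (fun y => f y + g y) x = D k f x + D k g x := by
  unfold D
  have := ((hf x).hasFDerivAt.add (hg x).hasFDerivAt).fderiv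
  have h2 : (fun y => f y + g y) = f + g := rfl
  rw [h2, this]; simp

lemma D_sub {f g : E2 → ℝ} (hf : Differentiable ℝ f) (hg : Differentiable ℝ g) (k : Fin 2) (x : E2) :
    D k (fun y => f y - g y) x = D k f x - D k g x := by
  unfold D
  have := ((hf x).hasFDerivAt.sub (hg x).hasFDerivAt).fderiv
  have h2 : (fun y => f y - g y) = f - g := rfl
  rw [h2, this]; simp

lemma D_neg {f : E2 → ℝ} (hf : Differentiable ℝ f) (k : Fin 2) (x : E2) :
    D k (fun y => - f y) x = - D k f x := by
  unfold D
  have := ((hf x).hasFDerivAt.neg).fderiv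
  have h2 : (fun y => - f y) = - f := rfl
  rw [h2, this]; simp

lemma D_mul {f g : E2 → ℝ} (hf : Differentiable ℝ f) (hg : Differentiable ℝ g) (k : Fin 2) (x : E2) :
    D k (fun y => f y * g y) x = f x * D k g x + D k f x * g x := by
  unfold D
  have := ((hf x).hasFDerivAt.mul (hg x).hasFDerivAt).fderiv
  have h2 : (fun y => f y * g y) = f * g := rfl
  rw [h2, this]; simp [mul_comm]

lemma D_const_mul {f : E2 → ℝ} (hf : Differentiable ℝ f) (c : ℝ) (k : Fin 2) (x : E2) :
    D k (fun y => c * f y) x = c * D k f x := by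
  unfold D
  have := ((hf x).hasFDerivAt.const_mul c).fderiv
  rw [this]; simp

lemma D_shift (f : E2 → ℝ) (v : E2) (k : Fin 2) (x : E2) :
    D k (fun y => f (y + v)) x = D k f (x + v) := by
  unfold D; rw [fderiv_comp_add_right]

lemma D_comp {f : E2 → ℝ} {g : ℝ → ℝ} (hf : Differentiable ℝ f) (hg : Differentiable ℝ g)
    (k : Fin 2) (x : E2) : D k (fun y => g (f y)) x = deriv g (f x) * D k f x := by
  unfold D
  have := ((hg (f x)).hasDerivAt.comp_hasFDerivAt x (hf x).hasFDerivAt).fderiv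
  have h2 : (fun y => g (f y)) = g ∘ f := rfl
  rw [h2, this]; simp

lemma D_symm {f : E2 → ℝ} (hf : ContDiff ℝ 2 f) (i j : Fin 2) (x : E2) :
    D i (D j f) x = D j (D i f) x := by
  have h : IsSymmSndFDerivAt ℝ f x := (hf.contDiffAt).isSymmSndFDerivAt (by simp)
  have hd : DifferentiableAt ℝ (fderiv ℝ f) x :=
    ((hf.fderiv_right (m := 1) (by norm_num)).differentiable one_ne_zero) x
  have key : ∀ i j : Fin 2, D i (D j f) x = fderiv ℝ (fderiv ℝ f) x (ek i) (ek j) := by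
    intro i j
    unfold D
    have : HasFDerivAt (fun y => fderiv ℝ f y (ek j))
      ((ContinuousLinearMap.apply ℝ ℝ (ek j)).comp (fderiv ℝ (fderiv ℝ f) x)) x :=
      (ContinuousLinearMap.apply ℝ ℝ (ek j)).hasFDerivAt.comp x hd.hasFDerivAt
    rw [this.fderiv]; rfl
  rw [key, key]; exact h _ _

lemma D_hcs {f : E2 → ℝ} (hf : HasCompactSupport f) (k : Fin 2) : HasCompactSupport (D k f) :=
  (hf.fderiv ℝ).comp_left (g := fun L : E2 →L[ℝ] ℝ => L (ek k)) (by simp)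

lemma D_eq_zero {f : E2 → ℝ} {x : E2} (hx : x ∉ tsupport f) (k : Fin 2) : D k f x = 0 := by
  unfold D
  have : fderiv ℝ f x = 0 := by
    by_contra h
    exact hx (support_fderiv_subset ℝ (f := f) (by simpa [Function.mem_support] using h))
  rw [this]; simp

lemma int_parts {f g : E2 → ℝ} (hf : ContDiff ℝ 1 f) (hg : ContDiff ℝ 1 g)
    (hgs : HasCompactSupport g) (k : Fin 2) :
    ∫ x, f x * D k g x = - ∫ x, D k f x * g x := by
  unfold D
  apply integral_mul_fderiv_eq_neg_fderiv_mul_of_integrable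
  · exact ((D_cont hf k).mul hg.continuous).integrable_of_hasCompactSupport hgs.mul_left
  · exact ((hf.continuous).mul (D_cont hg k)).integrable_of_hasCompactSupport (D_hcs hgs k).mul_left
  · exact ((hf.continuous).mul hg.continuous).integrable_of_hasCompactSupport hgs.mul_left
  · exact fun x _ => diff_of hf x
  · exact fun x _ => diff_of hg x

lemma int_D_zero {g : E2 → ℝ} (hg : ContDiff ℝ 1 g)
    (hgs : HasCompactSupport g) (k : Fin 2) : ∫ x, D k g x = 0 := by
  have := int_parts (f := fun _ => 1) contDiff_const hg hgs k
  have h2 : ∀ x, D k (fun _ : E2 => (1:ℝ)) x = 0 := by intro x; simp [D]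
  simpa [h2] using this

/-- continuity of integrals depending on a parameter, with uniformly compact support -/
lemma cont_param {f : ℝ → E2 → ℝ} (hf : Continuous (fun q : ℝ × E2 => f q.1 q.2)) {K : Set E2}
    (hK : IsCompact K) (h0 : ∀ s, ∀ x, x ∉ K → f s x = 0) : Continuous (fun s => ∫ x, f s x) := by
  have h1 : (fun s => ∫ x, f s x) = fun s => ∫ x in K, f s x := by
    funext s
    rw [setIntegral_eq_integral_of_forall_compl_eq_zero (fun x hx => h0 s x hx)]
  rw [h1]
  exact continuous_parametric_integral_of_continuous hf hK

end LPE

open MeasureTheory Real Filter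
/-! ## The nonlinearity -/
namespace LPE
open Topology

/-- h'(t) for h(t) = t log (1+t), t ≥ 0 -/
def hp (t : ℝ) : ℝ := Real.log (1 + t) + t / (1 + t)

lemma hp_deriv {t : ℝ} (ht : 0 ≤ t) : deriv (fun t : ℝ => t * Real.log (1 + t)) t = hp t := by
  have h1 : HasDerivAt (fun t : ℝ => 1 + t) 1 t := (hasDerivAt_id t).const_add 1
  have h2 := (hasDerivAt_id t).mul (h1.log (by positivity))
  have h3 : HasDerivAt (fun t : ℝ => t * Real.log (1 + t))
      (1 * Real.log (1 + t) + t * (1 / (1 + t))) t := h2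
  rw [h3.deriv, hp]; ring

lemma hp_zero : hp 0 = 0 := by simp [hp]

lemma hp_bounds {s t : ℝ} (hs : 0 ≤ s) (hst : s ≤ t) :
    (t - s) / (1 + t) ≤ hp t - hp s ∧ hp t - hp s ≤ 2 * (t - s) := by
  have h1s : 0 < 1 + s := by linarith
  have h1t : 0 < 1 + t := by linarith
  have e1 : hp t - hp s = Real.log ((1 + t) / (1 + s)) + (t - s) / ((1 + t) * (1 + s)) := by
    rw [Real.log_div h1t.ne' h1s.ne']; unfold hp; field_simp; ring
  have hq : 0 < (1 + t) / (1 + s) := by positivity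
  have u1 := Real.log_le_sub_one_of_pos hq
  have l1 := Real.one_sub_inv_le_log_of_pos hq
  have e2 : (1 + t) / (1 + s) - 1 = (t - s) / (1 + s) := by field_simp; ring
  have e3 : 1 - ((1 + t) / (1 + s))⁻¹ = (t - s) / (1 + t) := by field_simp; ring
  have hd : 0 ≤ t - s := by linarith
  have a1 : (t - s) / (1 + s) ≤ t - s := div_le_self hd (by linarith)
  have a2 : (t - s) / ((1 + t) * (1 + s)) ≤ t - s := div_le_self hd (by nlinarith)
  have a3 : 0 ≤ (t - s) / ((1 + t) * (1 + s)) := by positivity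
  rw [e1]
  constructor <;> linarith

/-- Frobenius norm of the trace free symmetric matrix (e, f; f, -e). -/
def tt (e f : ℝ) : ℝ := Real.sqrt (2 * (e ^ 2 + f ^ 2))

/-- h'(t)/t, zero at zero. -/
def cc (t : ℝ) : ℝ := if t = 0 then 0 else hp t / t

/-- as `cc`, but with value one at zero. -/
def cc1 (t : ℝ) : ℝ := if t = 0 then 1 else hp t / t

lemma tt_nonneg (e f : ℝ) : 0 ≤ tt e f := Real.sqrt_nonneg _

lemma tt_sq (e f : ℝ) : tt e f ^ 2 = 2 * (e ^ 2 + f ^ 2) := Real.sq_sqrt (by positivity)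

lemma cc_eq (e f : ℝ) : cc (tt e f) * e = cc1 (tt e f) * e ∧ cc (tt e f) * f = cc1 (tt e f) * f := by
  by_cases h : tt e f = 0
  · have := tt_sq e f
    rw [h] at this
    have he : e = 0 := by nlinarith [sq_nonneg e, sq_nonneg f]
    have hf : f = 0 := by nlinarith [sq_nonneg e, sq_nonneg f]
    simp [he, hf]
  · simp [cc, cc1, h]

lemma cc1_mul {t : ℝ} : cc1 t * t = hp t := by
  unfold cc1; split_ifs with h
  · simp [h, hp_zero]
  · field_simp

lemma cc1_bounds {t : ℝ} (ht : 0 ≤ t) : 1 / (1 + t) ≤ cc1 t ∧ cc1 t ≤ 2 := by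
  unfold cc1; split_ifs with h
  · simp [h]
  · have hpos : 0 < t := lt_of_le_of_ne ht (Ne.symm h)
    have := hp_bounds le_rfl ht
    rw [hp_zero] at this
    simp only [sub_zero] at this
    constructor
    · rw [le_div_iff₀ hpos]; calc 1 / (1 + t) * t = t / (1 + t) := by ring
        _ ≤ _ := this.1
    · rw [div_le_iff₀ hpos]; exact this.2

def PP (e f : ℝ) : ℝ := cc (tt e f) * e
def QQ (e f : ℝ) : ℝ := cc (tt e f) * f

lemma scalar_coco {t s p q : ℝ} (hs : 0 ≤ s) (ht : 0 ≤ t) (hp' : p = hp t) (hq' : q = hp s) :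
    (p - q) ^ 2 ≤ 2 * ((p - q) * (t - s)) ∧ (t - s) ^ 2 / (1 + t + s) ≤ (p - q) * (t - s) := by
  subst hp' hq'
  have main : ∀ a b : ℝ, 0 ≤ a → a ≤ b → (hp b - hp a) ^ 2 ≤ 2 * ((hp b - hp a) * (b - a)) ∧
      (b - a) ^ 2 / (1 + b + a) ≤ (hp b - hp a) * (b - a) := by
    intro a b ha hab
    obtain ⟨h1, h2⟩ := hp_bounds ha hab
    have h0 : 0 ≤ (b - a) / (1 + b) := div_nonneg (by linarith) (by linarith)
    have h3 : (b - a) / (1 + b + a) ≤ (b - a) / (1 + b) :=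
      div_le_div_of_nonneg_left (by linarith) (by linarith) (by linarith)
    constructor
    · nlinarith
    · have : (b - a) ^ 2 / (1 + b + a) = (b - a) / (1 + b + a) * (b - a) := by ring
      rw [this]
      exact mul_le_mul_of_nonneg_right (by linarith) (by linarith)
  rcases le_total s t with h | h
  · exact main s t hs h
  · have := main t s ht h
    constructor
    · nlinarith [this.1]
    · have e : (t - s) ^ 2 / (1 + t + s) = (s - t) ^ 2 / (1 + s + t) := by
        rw [show (1 + t + s) = 1 + s + t by ring]; ring
      rw [e]; nlinarith [this.2]

/-- Cocoercivity and weighted monotonicity. -/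
lemma coco (e f e' f' : ℝ) :
    (PP e f - PP e' f') ^ 2 + (QQ e f - QQ e' f') ^ 2 ≤
      2 * ((PP e f - PP e' f') * (e - e') + (QQ e f - QQ e' f') * (f - f')) ∧
    ((e - e') ^ 2 + (f - f') ^ 2) ≤ (1 + tt e f + tt e' f') *
      ((PP e f - PP e' f') * (e - e') + (QQ e f - QQ e' f') * (f - f')) := by
  unfold PP QQ
  rw [(cc_eq e f).1, (cc_eq e f).2, (cc_eq e' f').1, (cc_eq e' f').2]
  set t := tt e f with ht
  set s := tt e' f' with hs
  have ht0 : 0 ≤ t := tt_nonneg _ _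
  have hs0 : 0 ≤ s := tt_nonneg _ _
  have ht2 : t ^ 2 = 2 * (e ^ 2 + f ^ 2) := tt_sq _ _
  have hs2 : s ^ 2 = 2 * (e' ^ 2 + f' ^ 2) := tt_sq _ _
  have hr : 2 * (e * e' + f * f') ≤ t * s := by
    refine le_of_abs_le (abs_le_of_sq_le_sq ?_ (by positivity))
    rw [mul_pow t s, ht2, hs2]; nlinarith [sq_nonneg (e * f' - f * e')]
  obtain ⟨c1, c2⟩ := cc1_bounds ht0
  obtain ⟨d1, d2⟩ := cc1_bounds hs0
  obtain ⟨k1, k2⟩ := scalar_coco hs0 ht0 (cc1_mul (t := t)) (cc1_mul (t := s))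
  set c := cc1 t
  set d := cc1 s
  have m1 : 1 / (1 + t + s) ≤ 1 / (1 + t) := one_div_le_one_div_of_le (by linarith) (by linarith)
  have m2 : 1 / (1 + t + s) ≤ 1 / (1 + s) := one_div_le_one_div_of_le (by linarith) (by linarith)
  have hc0 : 0 ≤ c := le_trans (by positivity) c1
  have hd0 : 0 ≤ d := le_trans (by positivity) d1
  constructor
  · have hK : 0 ≤ c + d - c * d := by nlinarith
    have q1 : 2 * ((c * e - d * e') * (e - e') + (c * f - d * f') * (f - f')) =
        c * t ^ 2 + d * s ^ 2 - (c + d) * (2 * (e * e' + f * f')) := by rw [ht2, hs2]; ring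
    have q2 : 2 * ((c * e - d * e') ^ 2 + (c * f - d * f') ^ 2) =
        c ^ 2 * t ^ 2 + d ^ 2 * s ^ 2 - 2 * c * d * (2 * (e * e' + f * f')) := by
      rw [ht2, hs2]; ring
    rw [q1]
    nlinarith [mul_nonneg hK (sub_nonneg.2 hr)]
  · set m := 1 / (1 + t + s) with hm
    have hmpos : 0 < 1 + t + s := by linarith
    have hK : 0 ≤ c + d - 2 * m := by linarith
    have k3 : m * (t - s) ^ 2 ≤ (c * t - d * s) * (t - s) := by
      rw [hm]; calc _ = (t - s) ^ 2 / (1 + t + s) := by ring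
        _ ≤ _ := k2
    have key : m * ((e - e') ^ 2 + (f - f') ^ 2) ≤
      ((c * e - d * e') * (e - e') + (c * f - d * f') * (f - f')) := by
      nlinarith [mul_nonneg hK (sub_nonneg.2 hr)]
    calc (e - e') ^ 2 + (f - f') ^ 2 = (1 + t + s) * (m * ((e - e') ^ 2 + (f - f') ^ 2)) := by
          rw [hm]; field_simp
      _ ≤ _ := mul_le_mul_of_nonneg_left key hmpos.le

lemma PQ_lip (e f e' f' : ℝ) : (PP e f - PP e' f') ^ 2 + (QQ e f - QQ e' f') ^ 2 ≤
    4 * ((e - e') ^ 2 + (f - f') ^ 2) := by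
  have := (coco e f e' f').1
  nlinarith [sq_nonneg (PP e f - PP e' f' - 2 * (e - e')), sq_nonneg (QQ e f - QQ e' f' - 2 * (f - f'))]

lemma cont_of_sq {F : ℝ × ℝ → ℝ}
    (h : ∀ p q, (F p - F q) ^ 2 ≤ 4 * ((p.1 - q.1) ^ 2 + (p.2 - q.2) ^ 2)) : Continuous F := by
  have : LipschitzWith 4 F := by
    apply LipschitzWith.of_dist_le_mul
    intro p q
    rw [Real.dist_eq, Prod.dist_eq, Real.dist_eq, Real.dist_eq]
    set m := max |p.1 - q.1| |p.2 - q.2|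
    have hm : 0 ≤ m := le_max_of_le_left (abs_nonneg _)
    have h1 : |p.1 - q.1| ≤ m := le_max_left _ _
    have h2 : |p.2 - q.2| ≤ m := le_max_right _ _
    refine abs_le_of_sq_le_sq ?_ (by positivity)
    have h3 := h p q
    have h4 : (p.1 - q.1) ^ 2 ≤ m ^ 2 := sq_le_sq' (abs_le.1 h1).1 (abs_le.1 h1).2
    have h5 : (p.2 - q.2) ^ 2 ≤ m ^ 2 := sq_le_sq' (abs_le.1 h2).1 (abs_le.1 h2).2
    have : ((4 : NNReal) : ℝ) = 4 := rfl
    rw [this]; nlinarith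
  exact this.continuous

lemma PP_cont : Continuous (fun p : ℝ × ℝ => PP p.1 p.2) :=
  cont_of_sq fun p q => by nlinarith [PQ_lip p.1 p.2 q.1 q.2, sq_nonneg (QQ p.1 p.2 - QQ q.1 q.2)]

lemma QQ_cont : Continuous (fun p : ℝ × ℝ => QQ p.1 p.2) :=
  cont_of_sq fun p q => by nlinarith [PQ_lip p.1 p.2 q.1 q.2, sq_nonneg (PP p.1 p.2 - PP q.1 q.2)]

lemma tt_cont : Continuous (fun p : ℝ × ℝ => tt p.1 p.2) := by unfold tt; fun_prop

end LPE

open MeasureTheory Real Filter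
/-! ## The weak formulation in stream function form -/
namespace LPE
open Topology

lemma pd_eq {v : E2 → E2} (hv : Differentiable ℝ v) (k i : Fin 2) (x : E2) :
    pd v k x i = D k (fun y => v y i) x := by
  unfold pd D
  have h := ((EuclideanSpace.proj (𝕜 := ℝ) i).hasFDerivAt.comp x (hv x).hasFDerivAt).fderiv
  have h2 : (fun y => v y i) = (EuclideanSpace.proj (𝕜 := ℝ) i) ∘ v := rfl
  rw [h2, h]; rfl

/-- off-diagonal strain -/
def ff (a b : E2 → ℝ) (x : E2) : ℝ := (D 1 a x + D 0 b x) / 2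

def PF (a b : E2 → ℝ) (x : E2) : ℝ := PP (D 0 a x) (ff a b x)
def QF (a b : E2 → ℝ) (x : E2) : ℝ := QQ (D 0 a x) (ff a b x)

/-- first flux -/
def FW (a b : E2 → ℝ) (x : E2) : ℝ := 2 * PF a b x - a x ^ 2 + b x ^ 2
/-- second flux -/
def GW (a b : E2 → ℝ) (x : E2) : ℝ := QF a b x - a x * b x

lemma ff_cont {a b : E2 → ℝ} (ha : ContDiff ℝ 1 a) (hb : ContDiff ℝ 1 b) : Continuous (ff a b) :=
  ((D_cont ha 1).add (D_cont hb 0)).div_const 2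

lemma PF_cont {a b : E2 → ℝ} (ha : ContDiff ℝ 1 a) (hb : ContDiff ℝ 1 b) : Continuous (PF a b) :=
  PP_cont.comp ((D_cont ha 0).prodMk (ff_cont ha hb))

lemma QF_cont {a b : E2 → ℝ} (ha : ContDiff ℝ 1 a) (hb : ContDiff ℝ 1 b) : Continuous (QF a b) :=
  QQ_cont.comp ((D_cont ha 0).prodMk (ff_cont ha hb))

lemma FW_cont {a b : E2 → ℝ} (ha : ContDiff ℝ 1 a) (hb : ContDiff ℝ 1 b) : Continuous (FW a b) := by
  have := PF_cont ha hb; have := ha.continuous; have := hb.continuous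
  unfold FW; fun_prop

lemma GW_cont {a b : E2 → ℝ} (ha : ContDiff ℝ 1 a) (hb : ContDiff ℝ 1 b) : Continuous (GW a b) := by
  have := QF_cont ha hb; have := ha.continuous; have := hb.continuous
  unfold GW; fun_prop

lemma DH_entry {u : E2 → E2} (hu : Differentiable ℝ u) (hdiv : ∀ x, divg u x = 0) (x : E2) :
    DH (fun t : ℝ => t * Real.log (1 + t)) (symGrad u x) 0 0 =
        PF (fun y => u y 0) (fun y => u y 1) x ∧
    DH (fun t : ℝ => t * Real.log (1 + t)) (symGrad u x) 0 1 =
        QF (fun y => u y 0) (fun y => u y 1) x ∧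
    DH (fun t : ℝ => t * Real.log (1 + t)) (symGrad u x) 1 0 =
        QF (fun y => u y 0) (fun y => u y 1) x ∧
    DH (fun t : ℝ => t * Real.log (1 + t)) (symGrad u x) 1 1 =
        - PF (fun y => u y 0) (fun y => u y 1) x := by
  have hd := hdiv x
  simp only [divg, Fin.sum_univ_two, pd_eq hu] at hd
  set a : E2 → ℝ := fun y => u y 0
  set b : E2 → ℝ := fun y => u y 1
  have s00 : symGrad u x 0 0 = D 0 a x := by simp only [symGrad, pd_eq hu]; ring
  have s01 : symGrad u x 0 1 = ff a b x := by simp only [symGrad, pd_eq hu, ff, a, b]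
  have s10 : symGrad u x 1 0 = ff a b x := by simp only [symGrad, pd_eq hu, ff, a, b]; ring
  have s11 : symGrad u x 1 1 = - D 0 a x := by
    have : symGrad u x 1 1 = D 1 b x := by simp only [symGrad, pd_eq hu]; ring
    rw [this]; linarith
  have hfn : fnorm (symGrad u x) = tt (D 0 a x) (ff a b x) := by
    unfold fnorm frob tt
    simp only [Fin.sum_univ_two, s00, s01, s10, s11]
    congr 1; ring
  have hDH : ∀ i j, DH (fun t : ℝ => t * Real.log (1 + t)) (symGrad u x) i j =
      cc (tt (D 0 a x) (ff a b x)) * symGrad u x i j := by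
    intro i j
    unfold DH
    rw [hfn]
    unfold cc
    split_ifs with h
    · simp
    · rw [hp_deriv (tt_nonneg _ _)]; simp
  simp only [hDH, s00, s01, s10, s11, PF, QF, PP, QQ]
  refine ⟨trivial, trivial, trivial, by ring⟩

lemma int_combo {f g k l : E2 → ℝ} (hf : Integrable f) (hg : Integrable g) (hk : Integrable k)
    (hl : Integrable l) : ∫ x, (f x + g x - (k x + l x)) =
      ((∫ x, f x) + ∫ x, g x) - ((∫ x, k x) + ∫ x, l x) := by
  rw [← integral_add hf hg, ← integral_add hk hl]
  exact integral_sub (hf.add hg) (hk.add hl)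

lemma weak_smooth {u : E2 → E2} (hu : ContDiff ℝ 1 u) (hdiv : ∀ x, divg u x = 0)
    (hweak : IsWeakSolution (fun t : ℝ => t * Real.log (1 + t)) u)
    {ξ : E2 → ℝ} (hξ : ContDiff ℝ (⊤ : ℕ∞) ξ) (hs : HasCompactSupport ξ) :
    ∫ x, (FW (fun y => u y 0) (fun y => u y 1) x * D 0 (D 1 ξ) x +
      GW (fun y => u y 0) (fun y => u y 1) x * (D 1 (D 1 ξ) x - D 0 (D 0 ξ) x)) = 0 := by
  have hud : Differentiable ℝ u := hu.differentiable one_ne_zero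
  have hent := DH_entry hud hdiv
  have hd := hdiv
  simp only [divg, Fin.sum_univ_two, pd_eq hud] at hd
  have ha : ContDiff ℝ 1 (fun y => u y 0) := (contDiff_euclidean.1 hu) 0
  have hb : ContDiff ℝ 1 (fun y => u y 1) := (contDiff_euclidean.1 hu) 1
  have hξ2 : ContDiff ℝ 2 ξ := hξ.of_le (by norm_cast)
  have hs' : ∀ k, HasCompactSupport (D k ξ) := D_hcs hs
  have hs'' : ∀ k l, HasCompactSupport (D k (D l ξ)) := fun k l => D_hcs (hs' l) k
  have hc1 : ∀ k, ContDiff ℝ 1 (D k ξ) := D_contDiff hξ2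
  have hcc : ∀ k l, Continuous (D k (D l ξ)) := fun k l => D_cont (hc1 l) k
  set φ : E2 → E2 := fun x => !₂[D 1 ξ x, - D 0 ξ x] with hφ
  have hφ0 : ∀ x, φ x 0 = D 1 ξ x := fun x => rfl
  have hφ1 : ∀ x, φ x 1 = - D 0 ξ x := fun x => rfl
  have hφs : ContDiff ℝ (⊤ : ℕ∞) φ := by
    rw [contDiff_euclidean]
    intro i
    fin_cases i
    · exact D_contDiff_top hξ 1
    · exact (D_contDiff_top hξ 0).neg
  have hφd : Differentiable ℝ φ := hφs.differentiable (by simp)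
  have hφc : HasCompactSupport φ := by
    apply HasCompactSupport.intro (hs : IsCompact (tsupport ξ))
    intro x hx
    ext i
    fin_cases i
    · show D 1 ξ x = 0
      exact D_eq_zero hx 1
    · show - D 0 ξ x = 0
      rw [D_eq_zero hx 0, neg_zero]
  have p0 : ∀ k x, pd φ k x 0 = D k (D 1 ξ) x := fun k x => by
    rw [pd_eq hφd]; rfl
  have p1 : ∀ k x, pd φ k x 1 = - D k (D 0 ξ) x := fun k x => by
    rw [pd_eq hφd]; exact D_neg (diff_of (hc1 0)) k x
  have hφdiv : ∀ x, divg φ x = 0 := by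
    intro x
    simp only [divg, Fin.sum_univ_two, p0, p1]
    rw [D_symm hξ2 0 1]; ring
  have key := hweak φ hφs hφc hφdiv
  set a : E2 → ℝ := fun y => u y 0 with hadef
  set b : E2 → ℝ := fun y => u y 1 with hbdef
  have hac := ha.continuous
  have hbc := hb.continuous
  have hPc := PF_cont ha hb
  have hQc := QF_cont ha hb
  have hDa : ∀ k, Continuous (D k a) := D_cont ha
  have hDb : ∀ k, Continuous (D k b) := D_cont hb
  have hc1c : ∀ k, Continuous (D k ξ) := fun k => (hc1 k).continuous
  -- first integral
  have i1 : ∀ x, frob (DH (fun t : ℝ => t * Real.log (1 + t)) (symGrad u x)) (symGrad φ x) =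
      2 * PF a b x * D 0 (D 1 ξ) x + QF a b x * (D 1 (D 1 ξ) x - D 0 (D 0 ξ) x) := by
    intro x
    obtain ⟨h1, h2, h3, h4⟩ := hent x
    simp only [frob, Fin.sum_univ_two, h1, h2, h3, h4, symGrad, p0, p1]
    rw [D_symm hξ2 1 0]; ring
  have i2 : ∀ x, ∑ k, ∑ i, u x k * pd u k x i * φ x i =
      (a x * D 0 a x + b x * D 1 a x) * D 1 ξ x - (a x * D 0 b x + b x * D 1 b x) * D 0 ξ x := by
    intro x
    simp only [Fin.sum_univ_two, pd_eq hud, hφ0, hφ1, a, b]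
    ring
  simp only [i1, i2] at key
  -- divergence identity
  have cV0 : ContDiff ℝ 1 (fun x => a x * (a x * D 1 ξ x - b x * D 0 ξ x)) :=
    ha.mul ((ha.mul (hc1 1)).sub (hb.mul (hc1 0)))
  have cV1 : ContDiff ℝ 1 (fun x => b x * (a x * D 1 ξ x - b x * D 0 ξ x)) :=
    hb.mul ((ha.mul (hc1 1)).sub (hb.mul (hc1 0)))
  have sW : HasCompactSupport (fun x => a x * D 1 ξ x - b x * D 0 ξ x) :=
    (hs' 1).mul_left.sub (hs' 0).mul_left
  have z0 := int_D_zero cV0 sW.mul_left 0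
  have z1 := int_D_zero cV1 sW.mul_left 1
  have dW : ∀ k x, D k (fun x => a x * D 1 ξ x - b x * D 0 ξ x) x =
      (a x * D k (D 1 ξ) x + D k a x * D 1 ξ x) - (b x * D k (D 0 ξ) x + D k b x * D 0 ξ x) := by
    intro k x
    rw [D_sub (diff_of (ha.mul (hc1 1))) (diff_of (hb.mul (hc1 0))), D_mul (diff_of ha) (diff_of (hc1 1)),
      D_mul (diff_of hb) (diff_of (hc1 0))]
  have dV0 : ∀ x, D 0 (fun x => a x * (a x * D 1 ξ x - b x * D 0 ξ x)) x = _ := fun x =>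
    D_mul (diff_of ha) (diff_of ((ha.mul (hc1 1)).sub (hb.mul (hc1 0)))) 0 x
  have dV1 : ∀ x, D 1 (fun x => b x * (a x * D 1 ξ x - b x * D 0 ξ x)) x = _ := fun x =>
    D_mul (diff_of hb) (diff_of ((ha.mul (hc1 1)).sub (hb.mul (hc1 0)))) 1 x
  have I0 : Integrable (fun x => D 0 (fun x => a x * (a x * D 1 ξ x - b x * D 0 ξ x)) x) :=
    (D_cont cV0 0).integrable_of_hasCompactSupport (D_hcs sW.mul_left 0)
  have I1 : Integrable (fun x => D 1 (fun x => b x * (a x * D 1 ξ x - b x * D 0 ξ x)) x) :=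
    (D_cont cV1 1).integrable_of_hasCompactSupport (D_hcs sW.mul_left 1)
  have Ia : Integrable (fun x => 2 * PF a b x * D 0 (D 1 ξ) x +
      QF a b x * (D 1 (D 1 ξ) x - D 0 (D 0 ξ) x)) := by
    apply Continuous.integrable_of_hasCompactSupport
    · have := hcc 0 1; have := hcc 1 1; have := hcc 0 0; fun_prop
    · exact (hs'' 0 1).mul_left.add (((hs'' 1 1).sub (hs'' 0 0)).mul_left)
  have Ib : Integrable (fun x => (a x * D 0 a x + b x * D 1 a x) * D 1 ξ x -
      (a x * D 0 b x + b x * D 1 b x) * D 0 ξ x) := by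
    apply Continuous.integrable_of_hasCompactSupport
    · have := hDa 0; have := hDa 1; have := hDb 0; have := hDb 1
      have := hc1c 0; have := hc1c 1; fun_prop
    · exact (hs' 1).mul_left.sub (hs' 0).mul_left
  have tot : ∫ x, ((2 * PF a b x * D 0 (D 1 ξ) x +
      QF a b x * (D 1 (D 1 ξ) x - D 0 (D 0 ξ) x)) + ((a x * D 0 a x + b x * D 1 a x) * D 1 ξ x -
      (a x * D 0 b x + b x * D 1 b x) * D 0 ξ x) -
      (D 0 (fun x => a x * (a x * D 1 ξ x - b x * D 0 ξ x)) x +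
        D 1 (fun x => b x * (a x * D 1 ξ x - b x * D 0 ξ x)) x)) = 0 := by
    rw [int_combo Ia Ib I0 I1, z0, z1, key]
    ring
  rw [← tot]
  congr 1
  funext x
  rw [dV0, dV1, dW, dW]
  have hx : D 0 a x + D 1 b x = 0 := hd x
  have hb1 : D 1 b x = - D 0 a x := by linarith
  rw [hb1, D_symm hξ2 1 0]
  unfold FW GW
  ring
end LPE

open MeasureTheory Real Filter
/-! ## Mollification, stream function -/
namespace LPE
open Topology Convolution

/-- mollifier sequence -/
def mol (n : ℕ) : ContDiffBump (0 : E2) where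
  rIn := 1 / (2 * ((n : ℝ) + 1))
  rOut := 1 / ((n : ℝ) + 1)
  rIn_pos := by positivity
  rIn_lt_rOut := by
    apply one_div_lt_one_div_of_lt <;> [positivity; (have : (0:ℝ) ≤ n := Nat.cast_nonneg n; linarith)]

lemma mol_rOut : Tendsto (fun n => (mol n).rOut) atTop (𝓝 0) :=
  tendsto_one_div_add_atTop_nhds_zero_nat

/-- convolution with the mollifier -/
def cv (n : ℕ) (f : E2 → ℝ) : E2 → ℝ :=
  ((mol n).normed volume ⋆[ContinuousLinearMap.lsmul ℝ ℝ, volume] f)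

lemma cv_smooth {f : E2 → ℝ} (hf : Continuous f) (n : ℕ) : ContDiff ℝ (⊤ : ℕ∞) (cv n f) :=
  (mol n).hasCompactSupport_normed.contDiff_convolution_left _ (mol n).contDiff_normed
    hf.locallyIntegrable

lemma cv_supp {f : E2 → ℝ} (hs : HasCompactSupport f) (n : ℕ) : HasCompactSupport (cv n f) :=
  (mol n).hasCompactSupport_normed.convolution _ hs

lemma cv_D {f : E2 → ℝ} (hf : ContDiff ℝ 1 f) (hs : HasCompactSupport f) (n : ℕ) (k : Fin 2) :
    D k (cv n f) = cv n (D k f) := by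
  funext x
  have hloc : LocallyIntegrable ((mol n).normed volume) (volume : Measure E2) :=
    ((mol n).continuous_normed).locallyIntegrable
  have h := hs.hasFDerivAt_convolution_right (ContinuousLinearMap.lsmul ℝ ℝ) hloc hf x
  unfold D cv
  rw [h.fderiv]
  rw [convolution_precompR_apply _ hloc (hs.fderiv ℝ) (hf.continuous_fderiv one_ne_zero)]

lemma cv_tendsto {f : E2 → ℝ} (hf : Continuous f) (x : E2) :
    Tendsto (fun n => cv n f x) atTop (𝓝 (f x)) :=
  ContDiffBump.convolution_tendsto_right_of_continuous mol_rOut hf x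

lemma cv_bound {f : E2 → ℝ} {C : ℝ} (hC : ∀ x, |f x| ≤ C) (hf : Continuous f) (n : ℕ) (x : E2) :
    |cv n f x| ≤ C + 2 * C := by
  have := (mol n).dist_normed_convolution_le (μ := (volume : Measure E2)) (g := f) (x₀ := x) (ε := 2 * C)
    hf.aestronglyMeasurable (fun y _ => by
      rw [Real.dist_eq]; have := abs_sub (f y) (f x); have := hC x; have := hC y; linarith)
  rw [Real.dist_eq] at this
  have h2 := hC x
  have h3 : |cv n f x| ≤ |cv n f x - f x| + |f x| := by
    have := abs_add_le (cv n f x - f x) (f x); simpa using this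
  have h4 : |cv n f x - f x| ≤ 2 * C := this
  linarith

lemma cv_zero {f : E2 → ℝ} {R : ℝ} (hR : ∀ x, R ≤ ‖x‖ → f x = 0) (n : ℕ) {x : E2}
    (hx : R + 1 ≤ ‖x‖) : cv n f x = 0 := by
  have hball : ∀ y ∈ Metric.ball x (mol n).rOut, f y = f x := by
    intro y hy
    have h1 : (mol n).rOut ≤ 1 := by
      show 1 / ((n : ℝ) + 1) ≤ 1
      rw [div_le_one (by positivity)]; have : (0:ℝ) ≤ n := Nat.cast_nonneg n; linarith
    have h2 : dist y x < (mol n).rOut := hy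
    have h3 : ‖x‖ ≤ ‖y‖ + dist y x := by
      rw [dist_comm, dist_eq_norm]; have := norm_add_le y (x - y); simpa using this
    rw [hR y (by linarith), hR x (by linarith)]
  unfold cv
  rw [ContDiffBump.normed_convolution_eq_right hball, hR x (by linarith)]

lemma cv_int_tendsto {F f : E2 → ℝ} (hF : Continuous F) (hf : Continuous f)
    (hs : HasCompactSupport f) :
    Tendsto (fun n => ∫ x, F x * cv n f x) atTop (𝓝 (∫ x, F x * f x)) := by
  obtain ⟨C, hC⟩ := hs.exists_bound_of_continuous hf
  obtain ⟨R, hR⟩ := (hs : IsCompact (tsupport f)).isBounded.subset_ball 0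
  have hR' : ∀ x, R ≤ ‖x‖ → f x = 0 := by
    intro x hx
    by_contra h
    have := hR (subset_tsupport f h)
    simp at this; linarith
  set K := Metric.closedBall (0 : E2) (R + 1)
  have hK : IsCompact K := isCompact_closedBall _ _
  apply tendsto_integral_of_dominated_convergence
    (K.indicator (fun x => |F x| * (C + 2 * C)))
  · intro n
    exact (hF.mul (cv_smooth hf n).continuous).aestronglyMeasurable
  · rw [integrable_indicator_iff hK.measurableSet]
    exact (hF.abs.mul continuous_const).continuousOn.integrableOn_compact hK
  · intro n
    filter_upwards with x
    by_cases hx : x ∈ K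
    · rw [Set.indicator_of_mem hx, norm_mul]
      exact mul_le_mul_of_nonneg_left (cv_bound hC hf n x) (abs_nonneg _)
    · rw [Set.indicator_of_notMem hx, cv_zero hR' n]
      · simp
      · simp [K] at hx; linarith
  · filter_upwards with x
    exact (cv_tendsto hf x).const_mul _

lemma weak_C2 {F G : E2 → ℝ} (hF : Continuous F) (hG : Continuous G)
    (h : ∀ ξ : E2 → ℝ, ContDiff ℝ (⊤ : ℕ∞) ξ → HasCompactSupport ξ →
      ∫ x, (F x * D 0 (D 1 ξ) x + G x * (D 1 (D 1 ξ) x - D 0 (D 0 ξ) x)) = 0)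
    {ξ : E2 → ℝ} (hξ : ContDiff ℝ 2 ξ) (hs : HasCompactSupport ξ) :
    ∫ x, (F x * D 0 (D 1 ξ) x + G x * (D 1 (D 1 ξ) x - D 0 (D 0 ξ) x)) = 0 := by
  have hs' : ∀ k, HasCompactSupport (D k ξ) := D_hcs hs
  have hs'' : ∀ k l, HasCompactSupport (D k (D l ξ)) := fun k l => D_hcs (hs' l) k
  have hc1 : ∀ k, ContDiff ℝ 1 (D k ξ) := D_contDiff hξ
  have hcc : ∀ k l, Continuous (D k (D l ξ)) := fun k l => D_cont (hc1 l) k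
  have key : ∀ n k l, D k (D l (cv n ξ)) = cv n (D k (D l ξ)) := by
    intro n k l
    rw [cv_D (c1_of_c2 hξ) hs, cv_D (hc1 l) (hs' l)]
  have split : ∀ f g h : E2 → ℝ, Continuous f → Continuous g → Continuous h →
      HasCompactSupport f → HasCompactSupport g → HasCompactSupport h →
      ∫ x, (F x * f x + G x * (g x - h x)) = (∫ x, F x * f x) + ((∫ x, G x * g x) - ∫ x, G x * h x) := by
    intro f g h cf cg ch sf sg sh
    have i1 : Integrable (fun x => F x * f x) :=
      (hF.mul cf).integrable_of_hasCompactSupport sf.mul_left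
    have i2 : Integrable (fun x => G x * g x) :=
      (hG.mul cg).integrable_of_hasCompactSupport sg.mul_left
    have i3 : Integrable (fun x => G x * h x) :=
      (hG.mul ch).integrable_of_hasCompactSupport sh.mul_left
    rw [← integral_sub i2 i3]
    refine Eq.trans ?_ (integral_add i1 (i2.sub i3))
    congr 1; funext x; simp; ring
  have h0 : ∀ n, (∫ x, F x * cv n (D 0 (D 1 ξ)) x) + ((∫ x, G x * cv n (D 1 (D 1 ξ)) x) -
      ∫ x, G x * cv n (D 0 (D 0 ξ)) x) = 0 := by
    intro n
    have := h _ (cv_smooth hξ.continuous n) (cv_supp hs n)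
    simp only [key] at this
    rw [split _ _ _ (cv_smooth (hcc 0 1) n).continuous (cv_smooth (hcc 1 1) n).continuous
      (cv_smooth (hcc 0 0) n).continuous (cv_supp (hs'' 0 1) n) (cv_supp (hs'' 1 1) n)
      (cv_supp (hs'' 0 0) n)] at this
    exact this
  rw [split _ _ _ (hcc 0 1) (hcc 1 1) (hcc 0 0) (hs'' 0 1) (hs'' 1 1) (hs'' 0 0)]
  have lim := (cv_int_tendsto hF (hcc 0 1) (hs'' 0 1)).add
    ((cv_int_tendsto hG (hcc 1 1) (hs'' 1 1)).sub (cv_int_tendsto hG (hcc 0 0) (hs'' 0 0)))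
  simp only [h0] at lim
  exact (tendsto_nhds_unique lim tendsto_const_nhds)

lemma fderiv_decomp {f : E2 → ℝ} (x v : E2) :
    fderiv ℝ f x v = v 0 * D 0 f x + v 1 * D 1 f x := by
  have : v = v 0 • ek 0 + v 1 • ek 1 := by
    ext i; fin_cases i <;> simp [ek]
  conv_lhs => rw [this]
  rw [map_add, map_smul, map_smul]; rfl

/-- existence of a stream function -/
lemma exists_stream {a b : E2 → ℝ} (ha : ContDiff ℝ 1 a) (hb : ContDiff ℝ 1 b)
    (hd : ∀ x, D 0 a x + D 1 b x = 0) :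
    ∃ ψ : E2 → ℝ, ContDiff ℝ 2 ψ ∧ (∀ x, D 1 ψ x = a x) ∧ (∀ x, D 0 ψ x = - b x) := by
  let p : Fin 2 → (E2 →L[ℝ] ℝ) := fun i => EuclideanSpace.proj (𝕜 := ℝ) i
  have hpa : ∀ i (y : E2), p i y = y i := fun _ _ => rfl
  let ω : E2 → (E2 →L[ℝ] ℝ) := fun x => a x • p 1 - b x • p 0
  have hω : ContDiff ℝ 1 ω := (ha.smul contDiff_const).sub (hb.smul contDiff_const)
  have hωd : ∀ x, HasFDerivAt ω
      ((fderiv ℝ a x).smulRight (p 1) - (fderiv ℝ b x).smulRight (p 0)) x := by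
    intro x
    exact ((diff_of ha x).hasFDerivAt.smul_const (p 1)).sub ((diff_of hb x).hasFDerivAt.smul_const (p 0))
  obtain ⟨ψ, hψ⟩ := Convex.exists_forall_hasFDerivAt_of_fderiv_symmetric (s := Set.univ) (ω := ω)
    convex_univ isOpen_univ (fun x _ => (hωd x).differentiableAt.differentiableWithinAt) (by
      intro x _ v w
      rw [(hωd x).fderiv]
      simp only [sub_apply, ContinuousLinearMap.smulRight_apply,
        smul_apply, smul_eq_mul, hpa]
      rw [fderiv_decomp x v, fderiv_decomp x w, fderiv_decomp x v, fderiv_decomp x w]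
      have := hd x
      have h2 : D 1 b x = - D 0 a x := by linarith
      rw [h2]; ring)
  have hψ' : ∀ x, fderiv ℝ ψ x = ω x := fun x => (hψ x (Set.mem_univ _)).fderiv
  refine ⟨ψ, ?_, ?_, ?_⟩
  · have : (2 : WithTop ℕ∞) = 1 + 1 := by norm_num
    rw [this, contDiff_succ_iff_fderiv]
    refine ⟨fun x => (hψ x (Set.mem_univ _)).differentiableAt, by simp, ?_⟩
    have e : fderiv ℝ ψ = ω := funext hψ'
    rw [e]; exact hω
  · intro x; unfold D; rw [hψ' x]; simp [ω, p, ek]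
  · intro x; unfold D; rw [hψ' x]; simp [ω, p, ek]

end LPE

open MeasureTheory Real Filter
/-! ## Differences and the basic identity -/
namespace LPE
open Topology

/-- difference -/
def dl (v : E2) (f : E2 → ℝ) (x : E2) : ℝ := f (x + v) - f x
/-- average -/
def av (v : E2) (f : E2 → ℝ) (x : E2) : ℝ := (f (x + v) + f x) / 2

lemma shift_contDiff {n : WithTop ℕ∞} {f : E2 → ℝ} (hf : ContDiff ℝ n f) (v : E2) :
    ContDiff ℝ n (fun x => f (x + v)) := hf.comp (contDiff_id.add contDiff_const)

lemma dl_contDiff {n : WithTop ℕ∞} {f : E2 → ℝ} (hf : ContDiff ℝ n f) (v : E2) :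
    ContDiff ℝ n (dl v f) := (shift_contDiff hf v).sub hf

lemma av_contDiff {n : WithTop ℕ∞} {f : E2 → ℝ} (hf : ContDiff ℝ n f) (v : E2) :
    ContDiff ℝ n (av v f) := ((shift_contDiff hf v).add hf).div_const 2

lemma dl_cont {f : E2 → ℝ} (hf : Continuous f) (v : E2) : Continuous (dl v f) :=
  (hf.comp (continuous_id.add continuous_const)).sub hf

lemma D_dl {f : E2 → ℝ} (hf : ContDiff ℝ 1 f) (v : E2) (k : Fin 2) (x : E2) :
    D k (dl v f) x = dl v (D k f) x := by
  have := D_sub (diff_of (shift_contDiff hf v)) (diff_of hf) k x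
  rw [D_shift] at this
  exact this

lemma D_av {f : E2 → ℝ} (hf : ContDiff ℝ 1 f) (v : E2) (k : Fin 2) (x : E2) :
    D k (av v f) x = av v (D k f) x := by
  have h1 := D_add (diff_of (shift_contDiff hf v)) (diff_of hf) k x
  have h2 := D_const_mul (diff_of ((shift_contDiff hf v).add hf)) (1/2) k x
  have h3 : av v f = fun y => (1/2) * (f (y + v) + f y) := by
    funext y; unfold av; ring
  rw [h3]
  have h4 : D k (fun y => (1/2) * (f (y + v) + f y)) x = (1/2) * D k (fun y => f (y + v) + f y) x := h2
  rw [h4, h1, D_shift]; unfold av; ring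

/-- hypotheses collected -/
structure Sol (a b ψ : E2 → ℝ) (M : ℝ) : Prop where
  ha : ContDiff ℝ 1 a
  hb : ContDiff ℝ 1 b
  hψ : ContDiff ℝ 2 ψ
  hd : ∀ x, D 0 a x + D 1 b x = 0
  h1 : ∀ x, D 1 ψ x = a x
  h0 : ∀ x, D 0 ψ x = - b x
  hM : 1 ≤ M
  aM : ∀ x, |a x| ≤ M
  bM : ∀ x, |b x| ≤ M
  weak : ∀ ξ : E2 → ℝ, ContDiff ℝ 2 ξ → HasCompactSupport ξ →
    ∫ x, (FW a b x * D 0 (D 1 ξ) x + GW a b x * (D 1 (D 1 ξ) x - D 0 (D 0 ξ) x)) = 0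

/-- the dissipation quantity -/
def ZZ (a b : E2 → ℝ) (v : E2) (x : E2) : ℝ :=
  2 * (dl v (PF a b) x * dl v (D 0 a) x + dl v (QF a b) x * dl v (ff a b) x)

/-- cubic term -/
def TT (a b : E2 → ℝ) (v : E2) (x : E2) : ℝ :=
  dl v a x * (dl v a x * D 0 (av v a) x + dl v b x * D 1 (av v a) x)
  + dl v b x * (dl v a x * D 0 (av v b) x + dl v b x * D 1 (av v b) x)

/-- the right hand side -/
def RR (a b ψ η : E2 → ℝ) (v : E2) (x : E2) : ℝ :=
  - 2 * dl v (PF a b) x * (D 0 η x * dl v a x - D 1 η x * dl v b x + dl v ψ x * D 0 (D 1 η) x)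
  - dl v (QF a b) x * (2 * (D 1 η x * dl v a x + D 0 η x * dl v b x)
      + dl v ψ x * (D 1 (D 1 η) x - D 0 (D 0 η) x))
  + (2 * av v a x * dl v a x - 2 * av v b x * dl v b x) *
      (D 0 η x * dl v a x - D 1 η x * dl v b x + dl v ψ x * D 0 (D 1 η) x)
  + (av v a x * dl v b x + av v b x * dl v a x) * (2 * (D 1 η x * dl v a x + D 0 η x * dl v b x)
      + dl v ψ x * (D 1 (D 1 η) x - D 0 (D 0 η) x))
  - ((dl v a x) ^ 2 + (dl v b x) ^ 2) / 2 * (av v a x * D 0 η x + av v b x * D 1 η x)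
  - (av v a x * dl v a x + av v b x * dl v b x) * (dl v a x * D 0 η x + dl v b x * D 1 η x)

lemma weak_dl {a b ψ : E2 → ℝ} {M : ℝ} (S : Sol a b ψ M) {ξ : E2 → ℝ} (hξ : ContDiff ℝ 2 ξ)
    (hs : HasCompactSupport ξ) (v : E2) :
    ∫ x, (dl v (FW a b) x * D 0 (D 1 ξ) x + dl v (GW a b) x * (D 1 (D 1 ξ) x - D 0 (D 0 ξ) x)) = 0 := by
  have h1 := S.weak ξ hξ hs
  have hs2 : HasCompactSupport (fun x => ξ (x + (-v))) :=
    hs.comp_homeomorph (Homeomorph.addRight (-v))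
  have h2 := S.weak (fun x => ξ (x + (-v))) (shift_contDiff hξ _) hs2
  have hD : ∀ k l x, D k (D l (fun x => ξ (x + (-v)))) x = D k (D l ξ) (x + (-v)) := by
    intro k l x
    have : D l (fun x => ξ (x + (-v))) = fun x => D l ξ (x + (-v)) := by
      funext y; exact D_shift _ _ _ _
    rw [this]; exact D_shift _ _ _ _
  simp only [hD] at h2
  rw [← integral_add_right_eq_self _ v] at h2
  simp only [add_neg_cancel_right] at h2
  have hFc := FW_cont S.ha S.hb
  have hGc := GW_cont S.ha S.hb
  have hs' : ∀ k, HasCompactSupport (D k ξ) := D_hcs hs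
  have hs'' : ∀ k l, HasCompactSupport (D k (D l ξ)) := fun k l => D_hcs (hs' l) k
  have hc1 : ∀ k, ContDiff ℝ 1 (D k ξ) := D_contDiff hξ
  have hcc : ∀ k l, Continuous (D k (D l ξ)) := fun k l => D_cont (hc1 l) k
  have int : ∀ F G : E2 → ℝ, Continuous F → Continuous G → Integrable (fun x =>
      F x * D 0 (D 1 ξ) x + G x * (D 1 (D 1 ξ) x - D 0 (D 0 ξ) x)) := by
    intro F G hF hG
    have e0 := hcc 0 1; have e1 := hcc 1 1; have e2 := hcc 0 0
    apply Continuous.integrable_of_hasCompactSupport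
    · fun_prop
    · exact (hs'' 0 1).mul_left.add ((hs'' 1 1).sub (hs'' 0 0)).mul_left
  have h3 := integral_sub (int (fun x => FW a b (x + v)) (fun x => GW a b (x + v))
    (hFc.comp (continuous_id.add continuous_const))
    (hGc.comp (continuous_id.add continuous_const))) (int _ _ hFc hGc)
  rw [h1, h2, sub_zero] at h3
  rw [← h3]
  congr 1; funext x; unfold dl; ring

lemma cs_int {f g : E2 → ℝ} (hf : Continuous f) (hg : HasCompactSupport g)
    (h : ∀ x, x ∉ tsupport g → f x = 0) : Integrable f :=
  hf.integrable_of_hasCompactSupport (HasCompactSupport.intro hg h)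

lemma stage1_identity {a b ψ : E2 → ℝ} {M : ℝ} (S : Sol a b ψ M) {η : E2 → ℝ} (hη : ContDiff ℝ 2 η)
    (hs : HasCompactSupport η) (v : E2) :
    ∫ x, η x * ZZ a b v x = (∫ x, RR a b ψ η v x) - ∫ x, η x * TT a b v x := by
  have hα := dl_contDiff S.ha v
  have hβ := dl_contDiff S.hb v
  have hχ := dl_contDiff S.hψ v
  have hA := av_contDiff S.ha v
  have hB := av_contDiff S.hb v
  have hη1 := c1_of_c2 hη
  have hχ1 := c1_of_c2 hχ
  have d1χ : D 1 (dl v ψ) = dl v a := by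
    funext x; rw [D_dl (c1_of_c2 S.hψ)]; simp only [dl, S.h1]
  have d0χ : D 0 (dl v ψ) = fun x => - dl v b x := by
    funext x; rw [D_dl (c1_of_c2 S.hψ)]; simp only [dl, S.h0]; ring
  set ξ : E2 → ℝ := fun x => η x * dl v ψ x with hξd
  have hξ : ContDiff ℝ 2 ξ := hη.mul hχ
  have hξs : HasCompactSupport ξ := hs.mul_right
  have d1ξ : D 1 ξ = fun x => η x * dl v a x + D 1 η x * dl v ψ x := by
    funext x; rw [hξd, D_mul (diff_of hη1) (diff_of hχ1), d1χ]
  have d0ξ : D 0 ξ = fun x => η x * (- dl v b x) + D 0 η x * dl v ψ x := by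
    funext x; rw [hξd, D_mul (diff_of hη1) (diff_of hχ1), d0χ]
  have hDη : ∀ k, ContDiff ℝ 1 (D k η) := D_contDiff hη
  have dd : ∀ (k j : Fin 2) (w : E2 → ℝ) (_ : ContDiff ℝ 1 w) (x : E2),
      D k (fun x => η x * w x + D j η x * dl v ψ x) x =
      (η x * D k w x + D k η x * w x) + (D j η x * D k (dl v ψ) x + D k (D j η) x * dl v ψ x) := by
    intro k j w hw x
    rw [D_add (diff_of (hη1.mul hw)) (diff_of ((hDη j).mul hχ1)), D_mul (diff_of hη1) (diff_of hw),
      D_mul (diff_of (hDη j)) (diff_of hχ1)]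
  have d01 : ∀ x, D 0 (D 1 ξ) x = (η x * D 0 (dl v a) x + D 0 η x * dl v a x) +
      (D 1 η x * (- dl v b x) + D 0 (D 1 η) x * dl v ψ x) := by
    intro x; rw [d1ξ, dd 0 1 _ hα, d0χ]
  have d11 : ∀ x, D 1 (D 1 ξ) x = (η x * D 1 (dl v a) x + D 1 η x * dl v a x) +
      (D 1 η x * (dl v a x) + D 1 (D 1 η) x * dl v ψ x) := by
    intro x; rw [d1ξ, dd 1 1 _ hα, d1χ]
  have d00 : ∀ x, D 0 (D 0 ξ) x = (η x * (- D 0 (dl v b) x) + D 0 η x * (-dl v b x)) +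
      (D 0 η x * (-dl v b x) + D 0 (D 0 η) x * dl v ψ x) := by
    intro x; rw [d0ξ, dd 0 0 _ hβ.neg, d0χ, D_neg (diff_of hβ)]
  have hw := weak_dl S hξ hξs v
  -- the divergence field
  set V0 : E2 → ℝ := fun x => η x * (((dl v a x * dl v a x + dl v b x * dl v b x) * (1/2)) * av v a x
    + (av v a x * dl v a x + av v b x * dl v b x) * dl v a x) with hV0
  set V1 : E2 → ℝ := fun x => η x * (((dl v a x * dl v a x + dl v b x * dl v b x) * (1/2)) * av v b x
    + (av v a x * dl v a x + av v b x * dl v b x) * dl v b x) with hV1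
  have hq : ContDiff ℝ 1 (fun x => (dl v a x * dl v a x + dl v b x * dl v b x) * (1/2)) :=
    ((hα.mul hα).add (hβ.mul hβ)).mul contDiff_const
  have hr : ContDiff ℝ 1 (fun x => av v a x * dl v a x + av v b x * dl v b x) :=
    (hA.mul hα).add (hB.mul hβ)
  have hV0c : ContDiff ℝ 1 V0 := hη1.mul ((hq.mul hA).add (hr.mul hα))
  have hV1c : ContDiff ℝ 1 V1 := hη1.mul ((hq.mul hB).add (hr.mul hβ))
  have iV0 := int_D_zero hV0c hs.mul_right 0
  have iV1 := int_D_zero hV1c hs.mul_right 1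
  have dq : ∀ k x, D k (fun x => (dl v a x * dl v a x + dl v b x * dl v b x) * (1/2)) x =
      dl v a x * D k (dl v a) x + dl v b x * D k (dl v b) x := by
    intro k x
    rw [D_mul (diff_of ((hα.mul hα).add (hβ.mul hβ))) (diff_of contDiff_const),
      D_add (diff_of (hα.mul hα)) (diff_of (hβ.mul hβ)), D_mul (diff_of hα) (diff_of hα),
      D_mul (diff_of hβ) (diff_of hβ)]
    have : D k (fun _ : E2 => (1/2 : ℝ)) x = 0 := by simp [D]
    rw [this]; ring
  have dr : ∀ k x, D k (fun x => av v a x * dl v a x + av v b x * dl v b x) x =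
      (av v a x * D k (dl v a) x + D k (av v a) x * dl v a x) +
      (av v b x * D k (dl v b) x + D k (av v b) x * dl v b x) := by
    intro k x
    rw [D_add (diff_of (hA.mul hα)) (diff_of (hB.mul hβ)), D_mul (diff_of hA) (diff_of hα),
      D_mul (diff_of hB) (diff_of hβ)]
  have dV0 : ∀ x, D 0 V0 x = _ := fun x => by
    rw [hV0, D_mul (diff_of hη1) (diff_of ((hq.mul hA).add (hr.mul hα))),
      D_add (diff_of (hq.mul hA)) (diff_of (hr.mul hα)), D_mul (diff_of hq) (diff_of hA),
      D_mul (diff_of hr) (diff_of hα), dq, dr]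
  have dV1 : ∀ x, D 1 V1 x = _ := fun x => by
    rw [hV1, D_mul (diff_of hη1) (diff_of ((hq.mul hB).add (hr.mul hβ))),
      D_add (diff_of (hq.mul hB)) (diff_of (hr.mul hβ)), D_mul (diff_of hq) (diff_of hB),
      D_mul (diff_of hr) (diff_of hβ), dq, dr]
  -- divergence free
  have div1 : ∀ x, D 1 (dl v b) x = - D 0 (dl v a) x := by
    intro x; rw [D_dl S.ha, D_dl S.hb]; unfold dl
    have := S.hd x; have := S.hd (x + v); linarith
  have div2 : ∀ x, D 1 (av v b) x = - D 0 (av v a) x := by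
    intro x; rw [D_av S.ha, D_av S.hb]; unfold av
    have := S.hd x; have := S.hd (x + v); linarith
  have hff : ∀ x, dl v (ff a b) x = (D 1 (dl v a) x + D 0 (dl v b) x) / 2 := by
    intro x; rw [D_dl S.ha, D_dl S.hb]; unfold dl ff; ring
  have hee : ∀ x, dl v (D 0 a) x = D 0 (dl v a) x := fun x => (D_dl S.ha v 0 x).symm
  have hFF : ∀ x, dl v (FW a b) x = 2 * dl v (PF a b) x -
      (2 * av v a x * dl v a x - 2 * av v b x * dl v b x) := by
    intro x; unfold dl av FW; ring
  have hGG : ∀ x, dl v (GW a b) x = dl v (QF a b) x -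
      (av v a x * dl v b x + av v b x * dl v a x) := by
    intro x; unfold dl av GW; ring
  have pt : ∀ x, η x * ZZ a b v x = (RR a b ψ η v x - η x * TT a b v x) +
      ((dl v (FW a b) x * D 0 (D 1 ξ) x + dl v (GW a b) x * (D 1 (D 1 ξ) x - D 0 (D 0 ξ) x)) +
        (D 0 V0 x + D 1 V1 x)) := by
    intro x
    rw [dV0, dV1, d01, d11, d00, hFF, hGG]
    unfold ZZ RR TT
    rw [hff, hee, div1, div2]
    ring
  have cη := hη.continuous
  have cα := hα.continuous
  have cβ := hβ.continuous
  have cχ := hχ.continuous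
  have cA := hA.continuous
  have cB := hB.continuous
  have cDη : ∀ k, Continuous (D k η) := fun k => (hDη k).continuous
  have cDDη : ∀ k l, Continuous (D k (D l η)) := fun k l => D_cont (hDη l) k
  have cDA : ∀ k, Continuous (D k (av v a)) := D_cont hA
  have cDB : ∀ k, Continuous (D k (av v b)) := D_cont hB
  have cP := dl_cont (PF_cont S.ha S.hb) v
  have cQ := dl_cont (QF_cont S.ha S.hb) v
  have z0 : ∀ x, x ∉ tsupport η → η x = 0 := fun x hx => image_eq_zero_of_notMem_tsupport hx
  have z1 : ∀ k x, x ∉ tsupport η → D k η x = 0 := fun k x hx => D_eq_zero hx k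
  have z2 : ∀ k l x, x ∉ tsupport η → D k (D l η) x = 0 := fun k l x hx =>
    D_eq_zero (fun h => hx (closure_minimal (fun y hy => by
      by_contra h'; exact hy (z1 l y h')) (isClosed_tsupport η) h)) k
  have iR : Integrable (RR a b ψ η v) := by
    apply cs_int _ hs
    · intro x hx; unfold RR; rw [z1 0 x hx, z1 1 x hx, z2 0 1 x hx, z2 1 1 x hx, z2 0 0 x hx]; ring
    · have := cDη 0; have := cDη 1; have := cDDη 0 1; have := cDDη 0 0; have := cDDη 1 1
      unfold RR; fun_prop
  have iT : Integrable (fun x => η x * TT a b v x) := by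
    apply cs_int _ hs
    · intro x hx; rw [z0 x hx]; ring
    · have := cDA 0; have := cDA 1; have := cDB 0; have := cDB 1
      unfold TT; fun_prop
  have iD : Integrable (fun x => D 0 V0 x + D 1 V1 x) := by
    have j : ∀ g : E2 → ℝ, ContDiff ℝ 1 g → HasCompactSupport g → ∀ k, Integrable (D k g) :=
      fun g hg hgs k => (D_cont hg k).integrable_of_hasCompactSupport (D_hcs hgs k)
    exact (j V0 hV0c hs.mul_right 0).add (j V1 hV1c hs.mul_right 1)
  have iW : Integrable (fun x => dl v (FW a b) x * D 0 (D 1 ξ) x +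
      dl v (GW a b) x * (D 1 (D 1 ξ) x - D 0 (D 0 ξ) x)) := by
    have c1 := dl_cont (FW_cont S.ha S.hb) v
    have c2 := dl_cont (GW_cont S.ha S.hb) v
    have cc : ∀ k l, Continuous (D k (D l ξ)) := fun k l => D_cont (D_contDiff hξ l) k
    have e0 := cc 0 1; have e1 := cc 1 1; have e2 := cc 0 0
    have hs'' : ∀ k l, HasCompactSupport (D k (D l ξ)) := fun k l => D_hcs (D_hcs hξs l) k
    apply Continuous.integrable_of_hasCompactSupport
    · fun_prop
    · exact (hs'' 0 1).mul_left.add ((hs'' 1 1).sub (hs'' 0 0)).mul_left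
  have iD0 : ∫ x, (D 0 V0 x + D 1 V1 x) = 0 := by
    have j : ∀ g : E2 → ℝ, ContDiff ℝ 1 g → HasCompactSupport g → ∀ k, Integrable (D k g) :=
      fun g hg hgs k => (D_cont hg k).integrable_of_hasCompactSupport (D_hcs hgs k)
    rw [integral_add (j V0 hV0c hs.mul_right 0) (j V1 hV1c hs.mul_right 1), iV0, iV1, add_zero]
  simp only [pt]
  have e1 := integral_add (iR.sub iT) (iW.add iD)
  have e2 := integral_add iW iD
  have e3 := integral_sub iR iT
  simp only [Pi.sub_apply, Pi.add_apply] at e1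
  rw [e1, e2, e3, hw, iD0]; ring

end LPE

open MeasureTheory Real Filter
/-! ## Difference quotients and the first inequality -/
namespace LPE
open Topology

/-- difference quotient, extended to `s = 0` -/
def dqi (k : Fin 2) (f : E2 → ℝ) (s : ℝ) (x : E2) : ℝ :=
  ∫ t in (0:ℝ)..1, D k f (x + (t * s) • ek k)

lemma dqi_zero (k : Fin 2) (f : E2 → ℝ) (x : E2) : dqi k f 0 x = D k f x := by
  simp [dqi]

lemma dqi_cont {f : E2 → ℝ} (hf : ContDiff ℝ 1 f) (k : Fin 2) :
    Continuous (fun q : ℝ × E2 => dqi k f q.1 q.2) := by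
  unfold dqi
  apply intervalIntegral.continuous_parametric_intervalIntegral_of_continuous'
  have := D_cont hf k
  unfold Function.uncurry
  fun_prop

lemma dqi_eq {f : E2 → ℝ} (hf : ContDiff ℝ 1 f) (k : Fin 2) (s : ℝ) (x : E2) :
    s * dqi k f s x = dl (s • ek k) f x := by
  unfold dqi
  rw [← intervalIntegral.integral_const_mul]
  have hder : ∀ t : ℝ, HasDerivAt (fun t : ℝ => f (x + (t * s) • ek k)) (s * D k f (x + (t * s) • ek k)) t := by
    intro t
    have h1 : HasDerivAt (fun t : ℝ => x + (t * s) • ek k) ((1 * s) • ek k) t :=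
      (((hasDerivAt_id t).mul_const s).smul_const (ek k)).const_add x
    have h2 := ((diff_of hf (x + (t * s) • ek k)).hasFDerivAt).comp_hasDerivAt t h1
    have e : (fderiv ℝ f (x + (t * s) • ek k)) ((1 * s) • ek k) = s * D k f (x + (t * s) • ek k) := by
      rw [map_smul]; simp [D]
    rw [e] at h2
    exact h2
  rw [intervalIntegral.integral_eq_sub_of_hasDerivAt (fun t _ => hder t)]
  · simp [dl]
  · apply Continuous.intervalIntegrable
    have := D_cont hf k
    fun_prop

lemma dqi_bound {f : E2 → ℝ} (k : Fin 2) {M : ℝ} (hM : ∀ x, |D k f x| ≤ M) (s : ℝ) (x : E2) :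
    |dqi k f s x| ≤ M := by
  unfold dqi
  have := intervalIntegral.norm_integral_le_of_norm_le_const (a := 0) (b := 1)
    (f := fun t : ℝ => D k f (x + (t * s) • ek k)) (C := M) (fun t _ => hM _)
  simpa using this

lemma chi_bound {a b ψ : E2 → ℝ} {M : ℝ} (S : Sol a b ψ M) (k : Fin 2) (s : ℝ) (x : E2) :
    (dl (s • ek k) ψ x) ^ 2 ≤ M ^ 2 * s ^ 2 := by
  rw [← dqi_eq (c1_of_c2 S.hψ)]
  have h : |dqi k ψ s x| ≤ M := by
    apply dqi_bound
    intro y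
    fin_cases k
    · show |D 0 ψ y| ≤ M
      rw [S.h0, abs_neg]; exact S.bM y
    · show |D 1 ψ y| ≤ M
      rw [S.h1]; exact S.aM y
  have h2 : (dqi k ψ s x) ^ 2 ≤ M ^ 2 := by
    rw [← sq_abs]; exact pow_le_pow_left₀ (abs_nonneg _) h 2
  rw [mul_pow]; nlinarith [sq_nonneg s]

/-- convergence of integrals with continuous compactly supported parametrised integrands -/
lemma lim_param {f : ℝ → E2 → ℝ} (hf : Continuous (fun q : ℝ × E2 => f q.1 q.2)) {K : Set E2}
    (hK : IsCompact K) (h0 : ∀ s, ∀ x, x ∉ K → f s x = 0) {g : ℝ → E2 → ℝ}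
    (hg : ∀ s, 0 < s → ∀ x, g s x = f s x) :
    Tendsto (fun s => ∫ x, g s x) (𝓝[>] 0) (𝓝 (∫ x, f 0 x)) := by
  have h1 := ((cont_param hf hK h0).tendsto 0).mono_left (nhdsWithin_le_nhds (s := Set.Ioi 0))
  refine h1.congr' ?_
  filter_upwards [self_mem_nhdsWithin] with s hs
  congr 1; funext x; exact (hg s hs x).symm

lemma lim_W {a b ζ : E2 → ℝ} (ha : ContDiff ℝ 1 a) (hb : ContDiff ℝ 1 b) (hζ : Continuous ζ)
    (hs : HasCompactSupport ζ) (k : Fin 2) :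
    Tendsto (fun s => ∫ x, ζ x * ((dl (s • ek k) a x) ^ 2 + (dl (s • ek k) b x) ^ 2) / s ^ 2) (𝓝[>] 0)
      (𝓝 (∫ x, ζ x * ((D k a x) ^ 2 + (D k b x) ^ 2))) := by
  have := lim_param (f := fun s x => ζ x * ((dqi k a s x) ^ 2 + (dqi k b s x) ^ 2))
    (g := fun s x => ζ x * ((dl (s • ek k) a x) ^ 2 + (dl (s • ek k) b x) ^ 2) / s ^ 2)
    (by have := dqi_cont ha k; have := dqi_cont hb k; fun_prop) (K := tsupport ζ) hs
    (fun s x hx => by simp [image_eq_zero_of_notMem_tsupport hx])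
    (fun s hs x => by rw [← dqi_eq ha, ← dqi_eq hb]; field_simp)
  simpa only [dqi_zero] using this

lemma lim_T {a b η : E2 → ℝ} (ha : ContDiff ℝ 1 a) (hb : ContDiff ℝ 1 b)
    (hd : ∀ x, D 0 a x + D 1 b x = 0) (hη : Continuous η)
    (hs : HasCompactSupport η) :
    Tendsto (fun s => ∫ x, (η x * TT a b (s • ek 0) x / s ^ 2 + η x * TT a b (s • ek 1) x / s ^ 2))
      (𝓝[>] 0) (𝓝 0) := by
  let t : Fin 2 → ℝ → E2 → ℝ := fun k s x =>
    dqi k a s x * (dqi k a s x * av (s • ek k) (D 0 a) x + dqi k b s x * av (s • ek k) (D 1 a) x)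
    + dqi k b s x * (dqi k a s x * av (s • ek k) (D 0 b) x + dqi k b s x * av (s • ek k) (D 1 b) x)
  have ht : ∀ k, Continuous (fun q : ℝ × E2 => t k q.1 q.2) := by
    intro k
    have := dqi_cont ha k; have := dqi_cont hb k
    have := D_cont ha 0; have := D_cont ha 1; have := D_cont hb 0; have := D_cont hb 1
    simp only [t, av]
    fun_prop
  have := lim_param (f := fun s x => η x * t 0 s x + η x * t 1 s x)
    (g := fun s x => η x * TT a b (s • ek 0) x / s ^ 2 + η x * TT a b (s • ek 1) x / s ^ 2)
    (by have := ht 0; have := ht 1; fun_prop) (K := tsupport η) hs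
    (fun s x hx => by simp [image_eq_zero_of_notMem_tsupport hx])
    (fun s hs x => by
      have key : ∀ k, TT a b (s • ek k) x / s ^ 2 = t k s x := by
        intro k
        simp only [TT, t, D_av ha, D_av hb]
        rw [← dqi_eq ha, ← dqi_eq hb]
        field_simp
      rw [mul_div_assoc, mul_div_assoc, key, key])
  have z : ∫ x, (η x * t 0 0 x + η x * t 1 0 x) = 0 := by
    have hz : ∀ x, η x * t 0 0 x + η x * t 1 0 x = 0 := by
      intro x
      simp only [t, dqi_zero, av, zero_smul, add_zero]
      have h : D 1 b x = - D 0 a x := by have := hd x; linarith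
      rw [h]; ring
    simp only [hz, integral_zero]
  rw [z] at this
  exact this

lemma young {x A B : ℝ} (hA : 0 ≤ A) (hB : 0 ≤ B) (h : x ^ 2 ≤ 4 * A * B) : x ≤ A + B := by
  by_contra hc
  push Not at hc
  nlinarith [sq_nonneg (A - B)]

lemma yA {P N w η ζ K : ℝ} (hη : 0 ≤ η) (hζ : 0 ≤ ζ) (hK : 0 ≤ K) (hN : N ^ 2 ≤ K * η * ζ) :
    2 * P * N * w ≤ η * P ^ 2 / 8 + 8 * K * ζ * w ^ 2 := by
  apply young (by positivity) (by positivity)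
  have := mul_le_mul_of_nonneg_left hN (by positivity : 0 ≤ 4 * P ^ 2 * w ^ 2)
  nlinarith

lemma yB {c N w w' ζ M K : ℝ} (hζ : 0 ≤ ζ) (hK : 0 ≤ K) (hM : 0 ≤ M) (hc : |c| ≤ M) (hN : |N| ≤ K * ζ) :
    c * N * w * w' ≤ M * K * ζ * (w ^ 2 + w' ^ 2) / 2 := by
  have h1 : |c * N| ≤ M * (K * ζ) := by
    rw [abs_mul]; exact mul_le_mul hc hN (abs_nonneg _) hM
  have h2 : |w * w'| ≤ (w ^ 2 + w' ^ 2) / 2 := by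
    rw [abs_le]; constructor <;> nlinarith [sq_nonneg (w + w'), sq_nonneg (w - w')]
  have h3 : |c * N * (w * w')| ≤ M * (K * ζ) * ((w ^ 2 + w' ^ 2) / 2) := by
    rw [abs_mul]; exact mul_le_mul h1 h2 (abs_nonneg _) (by positivity)
  have := le_abs_self (c * N * (w * w'))
  nlinarith

lemma yC {c N w χ ζ r M K s : ℝ} (hζ : 0 ≤ ζ) (hr : 0 ≤ r) (hK : 0 ≤ K) (hc : |c| ≤ M)
    (hN : N ^ 2 ≤ K * ζ * r) (hχ : χ ^ 2 ≤ M ^ 2 * s ^ 2) :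
    2 * c * w * χ * N ≤ ζ * w ^ 2 + M ^ 4 * K * s ^ 2 * r := by
  apply young (by positivity) (by positivity)
  have h1 : c ^ 2 ≤ M ^ 2 := by
    rw [← sq_abs]; exact pow_le_pow_left₀ (abs_nonneg _) hc 2
  have h2 : c ^ 2 * χ ^ 2 ≤ M ^ 2 * (M ^ 2 * s ^ 2) :=
    mul_le_mul h1 hχ (by positivity) (by positivity)
  have h3 : c ^ 2 * χ ^ 2 * N ^ 2 ≤ M ^ 2 * (M ^ 2 * s ^ 2) * (K * ζ * r) :=
    mul_le_mul h2 hN (by positivity) (by positivity)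
  have := mul_le_mul_of_nonneg_left h3 (by positivity : 0 ≤ 4 * w ^ 2)
  nlinarith

lemma rr_bound {P Q α β χ A B N0 N1 N01 N11 N00 η ζ r M K s Z : ℝ} (hη : 0 ≤ η) (hζ : 0 ≤ ζ)
    (hr : 0 ≤ r) (hK : 0 ≤ K) (hM : 1 ≤ M) (hA : |A| ≤ M) (hB : |B| ≤ M)
    (hχ : χ ^ 2 ≤ M ^ 2 * s ^ 2) (hZ : P ^ 2 + Q ^ 2 ≤ Z)
    (a0 : N0 ^ 2 ≤ K * η * ζ) (a1 : N1 ^ 2 ≤ K * η * ζ) (b0 : |N0| ≤ K * ζ) (b1 : |N1| ≤ K * ζ)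
    (c0 : N01 ^ 2 ≤ K * η * r) (c1 : N11 ^ 2 ≤ K * η * r) (c2 : N00 ^ 2 ≤ K * η * r)
    (d0 : N01 ^ 2 ≤ K * ζ * r) (d1 : N11 ^ 2 ≤ K * ζ * r) (d2 : N00 ^ 2 ≤ K * ζ * r) :
    - 2 * P * (N0 * α - N1 * β + χ * N01) - Q * (2 * (N1 * α + N0 * β) + χ * (N11 - N00))
    + (2 * A * α - 2 * B * β) * (N0 * α - N1 * β + χ * N01)
    + (A * β + B * α) * (2 * (N1 * α + N0 * β) + χ * (N11 - N00))
    - (α ^ 2 + β ^ 2) / 2 * (A * N0 + B * N1) - (A * α + B * β) * (α * N0 + β * N1)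
    ≤ η * Z / 2 + 100 * (1 + K) * M ^ 4 * (ζ * (α ^ 2 + β ^ 2) + s ^ 2 * r) := by
  have hM0 : 0 ≤ M := by linarith
  have hA' : |(-A)| ≤ M := by rwa [abs_neg]
  have hB' : |(-B)| ≤ M := by rwa [abs_neg]
  have t1 := yA (P := P) (w := -α) hη hζ hK a0
  have t2 := yA (P := P) (w := β) hη hζ hK a1
  have t3 := yA (P := P) (w := -χ) hη hr hK c0
  have t4 := yA (P := Q) (w := -α) hη hζ hK a1
  have t5 := yA (P := Q) (w := -β) hη hζ hK a0
  have t6 := yA (P := Q) (w := -χ/2) hη hr hK c1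
  have t7 := yA (P := Q) (w := χ/2) hη hr hK c2
  -- convective
  have u1 := yB (w := α) (w' := α) hζ hK hM0 hA b0
  have u1' := yB (w := α) (w' := α) hζ hK hM0 hA' b0
  have u2 := yB (w := α) (w' := β) hζ hK hM0 hA b1
  have u2' := yB (w := α) (w' := β) hζ hK hM0 hA' b1
  have u3 := yB (w := α) (w' := β) hζ hK hM0 hB b0
  have u3' := yB (w := α) (w' := β) hζ hK hM0 hB' b0
  have u4 := yB (w := β) (w' := β) hζ hK hM0 hB b1
  have u4' := yB (w := β) (w' := β) hζ hK hM0 hB' b1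
  have u5 := yB (w := β) (w' := β) hζ hK hM0 hA b0
  have u5' := yB (w := β) (w' := β) hζ hK hM0 hA' b0
  have u6 := yB (w := α) (w' := α) hζ hK hM0 hB b1
  have u6' := yB (w := α) (w' := α) hζ hK hM0 hB' b1
  have w1 := yC (w := α) hζ hr hK hA d0 hχ
  have w2 := yC (w := β) hζ hr hK hB' d0 hχ
  have w3 := yC (w := β) hζ hr hK hA d1 hχ
  have w4 := yC (w := α) hζ hr hK hB d1 hχ
  have w5 := yC (w := β) hζ hr hK hA' d2 hχ
  have w6 := yC (w := α) hζ hr hK hB' d2 hχ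
  have e1 : η * (P ^ 2 + Q ^ 2) ≤ η * Z := mul_le_mul_of_nonneg_left hZ hη
  have e2 : K * r * χ ^ 2 ≤ K * r * (M ^ 2 * s ^ 2) := mul_le_mul_of_nonneg_left hχ (by positivity)
  have m2 : M ^ 2 ≤ M ^ 4 := pow_le_pow_right₀ hM (by norm_num)
  have m1 : M ≤ M ^ 4 := by simpa using pow_le_pow_right₀ hM (by norm_num : 1 ≤ 4)
  have m0 : 1 ≤ M ^ 4 := one_le_pow₀ hM
  have W0 : 0 ≤ ζ * (α ^ 2 + β ^ 2) := by positivity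
  have f1 : K * (ζ * (α ^ 2 + β ^ 2)) * M ≤ K * (ζ * (α ^ 2 + β ^ 2)) * M ^ 4 :=
    mul_le_mul_of_nonneg_left m1 (by positivity)
  have f2 : K * (ζ * (α ^ 2 + β ^ 2)) * 1 ≤ K * (ζ * (α ^ 2 + β ^ 2)) * M ^ 4 :=
    mul_le_mul_of_nonneg_left m0 (by positivity)
  have f3 : (ζ * (α ^ 2 + β ^ 2)) * 1 ≤ (ζ * (α ^ 2 + β ^ 2)) * M ^ 4 :=
    mul_le_mul_of_nonneg_left m0 (by positivity)
  have f4 : K * r * s ^ 2 * M ^ 2 ≤ K * r * s ^ 2 * M ^ 4 :=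
    mul_le_mul_of_nonneg_left m2 (by positivity)
  have f5 : 0 ≤ K * r * s ^ 2 * M ^ 4 := by positivity
  have f6 : 0 ≤ r * s ^ 2 * M ^ 4 := by positivity
  have f7 : 0 ≤ K * (ζ * (α ^ 2 + β ^ 2)) * M ^ 4 := by positivity
  have f8 : 0 ≤ M * K * ζ * α ^ 2 := by positivity
  have f9 : 0 ≤ M * K * ζ * β ^ 2 := by positivity
  have f10 : 0 ≤ ζ * α ^ 2 := by positivity
  have f11 : 0 ≤ ζ * β ^ 2 := by positivity
  have f12 : 0 ≤ η * P ^ 2 := by positivity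
  have f13 : 0 ≤ η * Q ^ 2 := by positivity
  have f14 : 0 ≤ K * r * χ ^ 2 := by positivity
  have s1 : -2 * P * (N0 * α - N1 * β + χ * N01) - Q * (2 * (N1 * α + N0 * β) + χ * (N11 - N00))
     ≤ η * Z / 2 + 16 * K * ζ * (α ^ 2 + β ^ 2) + 24 * (K * r * (M ^ 2 * s ^ 2)) := by
    linarith
  have s2 : (2 * A * α - 2 * B * β) * (N0 * α - N1 * β) + (A * β + B * α) * (2 * (N1 * α + N0 * β))
    - (α ^ 2 + β ^ 2) / 2 * (A * N0 + B * N1) - (A * α + B * β) * (α * N0 + β * N1)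
     ≤ 30 * (M * K * ζ * (α ^ 2 + β ^ 2)) := by
    linarith
  have s3 : (2 * A * α - 2 * B * β) * (χ * N01) + (A * β + B * α) * (χ * (N11 - N00)) ≤
     4 * (ζ * (α ^ 2 + β ^ 2)) + 4 * (M ^ 4 * K * s ^ 2 * r) := by
    linarith
  linarith

lemma coco1 (a b : E2 → ℝ) (v x : E2) :
    (dl v (PF a b) x) ^ 2 + (dl v (QF a b) x) ^ 2 ≤ ZZ a b v x :=
  (coco (D 0 a (x + v)) (ff a b (x + v)) (D 0 a x) (ff a b x)).1

/-- norm of the strain -/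
def ts (a b : E2 → ℝ) (x : E2) : ℝ := tt (D 0 a x) (ff a b x)

lemma coco2 (a b : E2 → ℝ) (v x : E2) :
    2 * ((dl v (D 0 a) x) ^ 2 + (dl v (ff a b) x) ^ 2) ≤
      (1 + ts a b (x + v) + ts a b x) * ZZ a b v x := by
  have := (coco (D 0 a (x + v)) (ff a b (x + v)) (D 0 a x) (ff a b x)).2
  unfold ZZ ts dl PF QF
  linarith

lemma ZZ_nonneg (a b : E2 → ℝ) (v x : E2) : 0 ≤ ZZ a b v x :=
  le_trans (by positivity) (coco1 a b v x)

lemma ZZ_cont {a b : E2 → ℝ} (ha : ContDiff ℝ 1 a) (hb : ContDiff ℝ 1 b) (v : E2) :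
    Continuous (ZZ a b v) := by
  have := dl_cont (PF_cont ha hb) v
  have := dl_cont (QF_cont ha hb) v
  have := dl_cont (ff_cont ha hb) v
  have := dl_cont (D_cont ha 0) v
  unfold ZZ; fun_prop

/-- structural assumptions on cutoffs -/
structure Cut (η ζ r : E2 → ℝ) (K : ℝ) : Prop where
  hK : 0 ≤ K
  cη : ContDiff ℝ 2 η
  sη : HasCompactSupport η
  pη : ∀ x, 0 ≤ η x
  cζ : ContDiff ℝ 1 ζ
  sζ : HasCompactSupport ζ
  pζ : ∀ x, 0 ≤ ζ x
  pr : ∀ x, 0 ≤ r x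
  ir : Integrable r
  h1 : ∀ i x, (D i η x) ^ 2 ≤ K * η x * ζ x
  h2 : ∀ i x, |D i η x| ≤ K * ζ x
  h3 : ∀ i j x, (D i (D j η) x) ^ 2 ≤ K * η x * r x
  h4 : ∀ i j x, (D i (D j η) x) ^ 2 ≤ K * ζ x * r x

lemma RR_int {a b ψ : E2 → ℝ} {M : ℝ} (S : Sol a b ψ M) {η : E2 → ℝ} (hη : ContDiff ℝ 2 η)
    (hs : HasCompactSupport η) (v : E2) : Integrable (RR a b ψ η v) := by
  have hDη : ∀ k, ContDiff ℝ 1 (D k η) := D_contDiff hη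
  have cα := (dl_contDiff S.ha v).continuous
  have cβ := (dl_contDiff S.hb v).continuous
  have cχ := (dl_contDiff S.hψ v).continuous
  have cA := (av_contDiff S.ha v).continuous
  have cB := (av_contDiff S.hb v).continuous
  have cDη : ∀ k, Continuous (D k η) := fun k => (hDη k).continuous
  have cDDη : ∀ k l, Continuous (D k (D l η)) := fun k l => D_cont (hDη l) k
  have cP := dl_cont (PF_cont S.ha S.hb) v
  have cQ := dl_cont (QF_cont S.ha S.hb) v
  have z1 : ∀ k x, x ∉ tsupport η → D k η x = 0 := fun k x hx => D_eq_zero hx k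
  have z2 : ∀ k l x, x ∉ tsupport η → D k (D l η) x = 0 := fun k l x hx =>
    D_eq_zero (fun h => hx (closure_minimal (fun y hy => by
      by_contra h'; exact hy (z1 l y h')) (isClosed_tsupport η) h)) k
  apply cs_int _ hs
  · intro x hx; unfold RR; rw [z1 0 x hx, z1 1 x hx, z2 0 1 x hx, z2 1 1 x hx, z2 0 0 x hx]; ring
  · have := cDη 0; have := cDη 1; have := cDDη 0 1; have := cDDη 0 0; have := cDDη 1 1
    unfold RR; fun_prop

lemma av_bound {f : E2 → ℝ} {M : ℝ} (h : ∀ x, |f x| ≤ M) (v x : E2) : |av v f x| ≤ M := by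
  have h1 := abs_le.1 (h x); have h2 := abs_le.1 (h (x + v))
  rw [abs_le]; unfold av; constructor <;> linarith

lemma stage1_k {a b ψ : E2 → ℝ} {M K : ℝ} (S : Sol a b ψ M) {η ζ r : E2 → ℝ} (C : Cut η ζ r K)
    (k : Fin 2) (s : ℝ) :
    ∫ x, η x * ZZ a b (s • ek k) x ≤ 200 * (1 + K) * M ^ 4 *
      ((∫ x, ζ x * ((dl (s • ek k) a x) ^ 2 + (dl (s • ek k) b x) ^ 2)) + s ^ 2 * ∫ x, r x)
      - 2 * ∫ x, η x * TT a b (s • ek k) x := by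
  set v := s • ek k with hv
  have id := stage1_identity S C.cη C.sη v
  have iZ : Integrable (fun x => η x * ZZ a b v x) :=
    (C.cη.continuous.mul (ZZ_cont S.ha S.hb v)).integrable_of_hasCompactSupport C.sη.mul_right
  have iW : Integrable (fun x => ζ x * ((dl v a x) ^ 2 + (dl v b x) ^ 2)) := by
    have := (dl_contDiff S.ha v).continuous
    have := (dl_contDiff S.hb v).continuous
    have := C.cζ.continuous
    exact Continuous.integrable_of_hasCompactSupport (by fun_prop) C.sζ.mul_right
  have iR := RR_int S C.cη C.sη v
  have le : ∫ x, RR a b ψ η v x ≤ ∫ x, ((1/2) * (η x * ZZ a b v x) + (100 * (1 + K) * M ^ 4) *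
      (ζ x * ((dl v a x) ^ 2 + (dl v b x) ^ 2) + s ^ 2 * r x)) := by
    apply integral_mono iR ((iZ.const_mul _).add ((iW.add (C.ir.const_mul _)).const_mul _))
    intro x
    have := rr_bound (P := dl v (PF a b) x) (Q := dl v (QF a b) x) (α := dl v a x) (β := dl v b x)
      (C.pη x) (C.pζ x) (C.pr x) C.hK S.hM (av_bound S.aM v x) (av_bound S.bM v x)
      (chi_bound S k s x) (coco1 a b v x) (C.h1 0 x) (C.h1 1 x) (C.h2 0 x) (C.h2 1 x)
      (C.h3 0 1 x) (C.h3 1 1 x) (C.h3 0 0 x) (C.h4 0 1 x) (C.h4 1 1 x) (C.h4 0 0 x)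
    show RR a b ψ η v x ≤ (1/2) * (η x * ZZ a b v x) + (100 * (1 + K) * M ^ 4) *
      (ζ x * ((dl v a x) ^ 2 + (dl v b x) ^ 2) + s ^ 2 * r x)
    unfold RR
    linarith
  have e1 := integral_add (iZ.const_mul (1/2))
    ((iW.add (C.ir.const_mul (s ^ 2))).const_mul (100 * (1 + K) * M ^ 4))
  have e2 := integral_add iW (C.ir.const_mul (s ^ 2))
  simp only [Pi.add_apply] at e1
  rw [e1, integral_const_mul, integral_const_mul, e2, integral_const_mul] at le
  linarith

end LPE

open MeasureTheory Real Filter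
/-! ## Weighted gradient estimate -/
namespace LPE
open Topology

lemma null_lag {b g : E2 → ℝ} (hb : ContDiff ℝ 1 b) (hg : ContDiff ℝ 1 g) (hs : HasCompactSupport g) :
    ∫ x, D 0 b x * D 1 g x = ∫ x, D 1 b x * D 0 g x := by
  have l1 := cv_int_tendsto (D_cont hb 0) (D_cont hg 1) (D_hcs hs 1)
  have l2 := cv_int_tendsto (D_cont hb 1) (D_cont hg 0) (D_hcs hs 0)
  have e : ∀ n, ∫ x, D 0 b x * cv n (D 1 g) x = ∫ x, D 1 b x * cv n (D 0 g) x := by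
    intro n
    rw [← cv_D hg hs, ← cv_D hg hs]
    have sm := cv_smooth hg.continuous n
    have sm2 : ContDiff ℝ 2 (cv n g) := sm.of_le (by norm_cast)
    have i1 := int_parts hb (D_contDiff sm2 1) (D_hcs (cv_supp hs n) 1) 0
    have i2 := int_parts hb (D_contDiff sm2 0) (D_hcs (cv_supp hs n) 0) 1
    have : ∫ x, b x * D 0 (D 1 (cv n g)) x = ∫ x, b x * D 1 (D 0 (cv n g)) x := by
      congr 1; funext x; rw [D_symm sm2 0 1]
    linarith
  simp only [e] at l1
  exact tendsto_nhds_unique l1 l2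

/-- squared gradient -/
def gr (a b : E2 → ℝ) (x : E2) : ℝ :=
  ((D 0 a x) ^ 2 + (D 0 b x) ^ 2) + ((D 1 a x) ^ 2 + (D 1 b x) ^ 2)

lemma gr_nonneg (a b : E2 → ℝ) (x : E2) : 0 ≤ gr a b x := by unfold gr; positivity

lemma gr_cont {a b : E2 → ℝ} (ha : ContDiff ℝ 1 a) (hb : ContDiff ℝ 1 b) : Continuous (gr a b) := by
  have := D_cont ha 0; have := D_cont ha 1; have := D_cont hb 0; have := D_cont hb 1
  unfold gr; fun_prop

lemma lim_shift {F A : E2 → ℝ} (hF : Continuous F) (hA : ContDiff ℝ 1 A) (hs : HasCompactSupport A)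
    (k : Fin 2) :
    Tendsto (fun s : ℝ => - ∫ x, dl (s • ek k) F x / s * A x) (𝓝[>] 0) (𝓝 (∫ x, F x * D k A x)) := by
  let c : ℝ → ℝ := fun s => - max 0 (min s 1)
  have hc : Continuous c := by simp only [c]; fun_prop
  have hc1 : ∀ s, |c s| ≤ 1 := by
    intro s; simp only [c, abs_neg]
    rw [abs_of_nonneg (le_max_left _ _)]
    exact max_le zero_le_one (min_le_right _ _)
  have hcs : ∀ s, 0 < s → s < 1 → c s = - s := by
    intro s h1 h2; simp only [c]; rw [min_eq_left h2.le, max_eq_right h1.le]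
  let f : ℝ → E2 → ℝ := fun s x => F x * dqi k A (c s) x
  have hf : Continuous (fun q : ℝ × E2 => f q.1 q.2) := by
    have h1 : Continuous (fun q : ℝ × E2 => dqi k A (c q.1) q.2) :=
      (dqi_cont hA k).comp ((hc.comp continuous_fst).prodMk continuous_snd)
    exact (hF.comp continuous_snd).mul h1
  have hK : IsCompact (Metric.cthickening 1 (tsupport A)) := IsCompact.cthickening hs
  have h0 : ∀ s x, x ∉ Metric.cthickening 1 (tsupport A) → f s x = 0 := by
    intro s x hx
    have : dqi k A (c s) x = 0 := by
      unfold dqi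
      apply intervalIntegral.integral_zero_ae
      filter_upwards with t ht
      apply D_eq_zero
      intro hmem
      apply hx
      apply Metric.mem_cthickening_of_dist_le x _ _ _ hmem
      rw [dist_eq_norm]
      have : x - (x + (t * c s) • ek k) = (-(t * c s)) • ek k := by
        rw [neg_smul]; abel
      rw [this, norm_smul, norm_ek, mul_one, norm_neg, norm_mul]
      rw [Set.uIoc_of_le zero_le_one] at ht
      have h1 : ‖t‖ ≤ 1 := by rw [Real.norm_eq_abs, abs_of_pos ht.1]; exact ht.2
      exact mul_le_one₀ h1 (norm_nonneg _) (hc1 s)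
    simp only [f, this, mul_zero]
  have lim := ((cont_param hf hK h0).tendsto 0).mono_left (nhdsWithin_le_nhds (s := Set.Ioi 0))
  have e0 : ∫ x, f 0 x = ∫ x, F x * D k A x := by
    have : c 0 = 0 := by simp [c]
    simp only [f, this, dqi_zero]
  rw [e0] at lim
  refine lim.congr' ?_
  filter_upwards [Ioo_mem_nhdsGT (zero_lt_one (α := ℝ))] with s hs1
  have hsp : 0 < s := hs1.1
  have hA0 := hA.continuous
  -- compute
  have i1 : Integrable (fun x => F x * A (x + (-s) • ek k) / s) := by
    apply Continuous.integrable_of_hasCompactSupport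
    · fun_prop
    · have hh : HasCompactSupport (fun x => A (x + (-s) • ek k)) :=
        hs.comp_homeomorph (Homeomorph.addRight ((-s) • ek k))
      have := (hh.mul_left (f := F)).mul_right (f' := fun _ => s⁻¹)
      exact this
  have i2 : Integrable (fun x => F x * A x / s) := by
    apply Continuous.integrable_of_hasCompactSupport
    · fun_prop
    · have := (hs.mul_left (f := F)).mul_right (f' := fun _ => s⁻¹)
      exact this
  have i3 : Integrable (fun x => F (x + s • ek k) * A x / s) := by
    apply Continuous.integrable_of_hasCompactSupport
    · fun_prop
    · have := (hs.mul_left (f := fun x => F (x + s • ek k))).mul_right (f' := fun _ => s⁻¹)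
      exact this
  have l1 : ∫ x, f s x = (∫ x, F x * A x / s) - ∫ x, F x * A (x + (-s) • ek k) / s := by
    rw [← integral_sub i2 i1]
    congr 1; funext x
    have := dqi_eq hA k (-s) x
    simp only [f, hcs s hs1.1 hs1.2]
    unfold dl at this
    have h2 : dqi k A (-s) x = (A x - A (x + (-s) • ek k)) / s := by
      rw [eq_div_iff hsp.ne']; linarith
    rw [h2]; ring
  have l2 : ∫ x, F x * A (x + (-s) • ek k) / s = ∫ x, F (x + s • ek k) * A x / s := by
    rw [← integral_add_right_eq_self _ (s • ek k)]
    congr 1; funext x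
    have : x + s • ek k + (-s) • ek k = x := by rw [neg_smul, add_neg_cancel_right]
    rw [this]
  rw [l1, l2, ← integral_sub i2 i3, ← integral_neg]
  congr 1; funext x; unfold dl; ring

/-- difference-quotient form of the weighted Dirichlet energy -/
def II (a b ω : E2 → ℝ) (s : ℝ) : ℝ :=
  ∫ x, -(2 * a x * (dl (s • ek 0) (D 0 a) x + dl (s • ek 1) (ff a b) x) +
    2 * b x * (dl (s • ek 0) (ff a b) x - dl (s • ek 1) (D 0 a) x)) * ω x / s

lemma II_lim {a b ω : E2 → ℝ} (ha : ContDiff ℝ 1 a) (hb : ContDiff ℝ 1 b)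
    (hd : ∀ x, D 0 a x + D 1 b x = 0) (hω : ContDiff ℝ 1 ω) (hs : HasCompactSupport ω) :
    Tendsto (II a b ω) (𝓝[>] 0) (𝓝 ((∫ x, ω x * gr a b x) + ∫ x,
      ((a x * D 0 a x + b x * D 0 b x) * D 0 ω x + (a x * D 1 a x + b x * D 1 b x) * D 1 ω x))) := by
  have hA : ContDiff ℝ 1 (fun x => ω x * a x) := hω.mul ha
  have hB : ContDiff ℝ 1 (fun x => ω x * b x) := hω.mul hb
  have hAs : HasCompactSupport (fun x => ω x * a x) := hs.mul_right
  have hBs : HasCompactSupport (fun x => ω x * b x) := hs.mul_right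
  have ce := D_cont ha 0
  have cf := ff_cont ha hb
  have l1 := lim_shift ce hA hAs 0
  have l2 := lim_shift cf hA hAs 1
  have l3 := lim_shift cf hB hBs 0
  have l4 := lim_shift ce hB hBs 1
  have lim := (((l1.add l2).add (l3.sub l4)).const_mul 2)
  have cc := hω.continuous
  have ca := ha.continuous
  have cb := hb.continuous
  have intA : ∀ F G : E2 → ℝ, Continuous F → Continuous G → HasCompactSupport G →
    Integrable (fun x => F x * G x) := fun F G hF hG hGs =>
      (hF.mul hG).integrable_of_hasCompactSupport hGs.mul_left
  have nl1 := null_lag hb hA hAs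
  have nl2 := null_lag ha hB hBs
  have cD : ∀ k, Continuous (D k (fun x => ω x * a x)) := D_cont hA
  have cD' : ∀ k, Continuous (D k (fun x => ω x * b x)) := D_cont hB
  have sD : ∀ k, HasCompactSupport (D k (fun x => ω x * a x)) := D_hcs hAs
  have sD' : ∀ k, HasCompactSupport (D k (fun x => ω x * b x)) := D_hcs hBs
  have ca0 := D_cont ha 0
  have ca1 := D_cont ha 1
  have cb0 := D_cont hb 0
  have cb1 := D_cont hb 1
  have co0 := D_cont hω 0
  have co1 := D_cont hω 1
  have value : 2 * (((∫ x, D 0 a x * D 0 (fun x => ω x * a x) x) + ∫ x, ff a b x * D 1 (fun x => ω x * a x) x) +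
      ((∫ x, ff a b x * D 0 (fun x => ω x * b x) x) - ∫ x, D 0 a x * D 1 (fun x => ω x * b x) x)) =
      (∫ x, ω x * gr a b x) + ∫ x,
      ((a x * D 0 a x + b x * D 0 b x) * D 0 ω x + (a x * D 1 a x + b x * D 1 b x) * D 1 ω x) := by
    have j1 := intA _ _ ce (cD 0) (sD 0)
    have j2 := intA _ _ cf (cD 1) (sD 1)
    have j3 := intA _ _ cf (cD' 0) (sD' 0)
    have j4 := intA _ _ ce (cD' 1) (sD' 1)
    have n1 := intA _ _ cb0 (cD 1) (sD 1)
    have n2 := intA _ _ cb1 (cD 0) (sD 0)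
    have n3 := intA _ _ ca0 (cD' 1) (sD' 1)
    have n4 := intA _ _ ca1 (cD' 0) (sD' 0)
    have g1 : Integrable (fun x => ω x * gr a b x) :=
      (cc.mul (gr_cont ha hb)).integrable_of_hasCompactSupport hs.mul_right
    have g2 : Integrable (fun x => (a x * D 0 a x + b x * D 0 b x) * D 0 ω x +
        (a x * D 1 a x + b x * D 1 b x) * D 1 ω x) := by
      apply (intA _ _ (by fun_prop) co0 (D_hcs hs 0)).add (intA _ _ (by fun_prop) co1 (D_hcs hs 1))
    have e1 := integral_add j1 j2
    have e2 := integral_sub j3 j4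
    have e3 := integral_add (j1.add j2) (j3.sub j4)
    have e4 := integral_sub n1 n2
    have e5 := integral_sub n4 n3
    have e6 := integral_add g1 g2
    have e7 := integral_add (n1.sub n2) (n4.sub n3)
    have e8 := integral_sub (((j1.add j2).add (j3.sub j4)).const_mul 2) ((n1.sub n2).add (n4.sub n3))
    simp only [Pi.add_apply, Pi.sub_apply] at e1 e2 e3 e4 e5 e6 e7 e8
    rw [integral_const_mul] at e8
    have e9 : ∫ x, (ω x * gr a b x + ((a x * D 0 a x + b x * D 0 b x) * D 0 ω x +
        (a x * D 1 a x + b x * D 1 b x) * D 1 ω x)) = ∫ x, (2 * (D 0 a x * D 0 (fun x => ω x * a x) x +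
          ff a b x * D 1 (fun x => ω x * a x) x + (ff a b x * D 0 (fun x => ω x * b x) x -
          D 0 a x * D 1 (fun x => ω x * b x) x)) - (D 0 b x * D 1 (fun x => ω x * a x) x -
          D 1 b x * D 0 (fun x => ω x * a x) x + (D 1 a x * D 0 (fun x => ω x * b x) x -
          D 0 a x * D 1 (fun x => ω x * b x) x))) := by
      congr 1; funext x
      have h : D 1 b x = - D 0 a x := by have := hd x; linarith
      simp only [D_mul (diff_of hω) (diff_of ha), D_mul (diff_of hω) (diff_of hb), gr, ff, h]
      ring
    linarith
  rw [value] at lim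
  refine lim.congr' ?_
  filter_upwards [self_mem_nhdsWithin] with s hs0
  have d1 : ∀ v, Continuous (dl v (D 0 a)) := dl_cont ce
  have d2 : ∀ v, Continuous (dl v (ff a b)) := dl_cont cf
  have j1 := intA _ _ ((d1 (s • ek 0)).div_const s) hA.continuous hAs
  have j2 := intA _ _ ((d2 (s • ek 1)).div_const s) hA.continuous hAs
  have j3 := intA _ _ ((d2 (s • ek 0)).div_const s) hB.continuous hBs
  have j4 := intA _ _ ((d1 (s • ek 1)).div_const s) hB.continuous hBs
  have e1 := integral_add j1 j2
  have e2 := integral_sub j3 j4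
  have e3 := integral_add (j1.add j2) (j3.sub j4)
  simp only [Pi.add_apply, Pi.sub_apply] at e3
  have e4 : II a b ω s = -2 * ∫ x, (dl (s • ek 0) (D 0 a) x / s * (ω x * a x) +
      dl (s • ek 1) (ff a b) x / s * (ω x * a x) + (dl (s • ek 0) (ff a b) x / s * (ω x * b x) -
      dl (s • ek 1) (D 0 a) x / s * (ω x * b x))) := by
    rw [← integral_const_mul]; unfold II
    congr 1; funext x; ring
  rw [e4, e3, e1, e2]; ring

/-- total dissipation -/
def JJ (a b η : E2 → ℝ) (s : ℝ) : ℝ :=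
  ((∫ x, η x * ZZ a b (s • ek 0) x) + ∫ x, η x * ZZ a b (s • ek 1) x) / s ^ 2

lemma ts_cont {a b : E2 → ℝ} (ha : ContDiff ℝ 1 a) (hb : ContDiff ℝ 1 b) : Continuous (ts a b) :=
  tt_cont.comp ((D_cont ha 0).prodMk (ff_cont ha hb))

lemma ts_nonneg (a b : E2 → ℝ) (x : E2) : 0 ≤ ts a b x := tt_nonneg _ _

lemma ts_sq (a b : E2 → ℝ) (x : E2) : (ts a b x) ^ 2 ≤ 2 * gr a b x := by
  unfold ts; rw [tt_sq]; unfold gr ff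
  nlinarith [sq_nonneg (D 1 a x - D 0 b x), sq_nonneg (D 1 b x), sq_nonneg (D 0 b x),
    sq_nonneg (D 1 a x)]

lemma lim_rho {a b ρ : E2 → ℝ} (ha : ContDiff ℝ 1 a) (hb : ContDiff ℝ 1 b) (hρ : Continuous ρ)
    (hs : HasCompactSupport ρ) (k : Fin 2) :
    Tendsto (fun s : ℝ => ∫ x, ρ x * (1 + ts a b (x + s • ek k) + ts a b x)) (𝓝[>] 0)
      (𝓝 (∫ x, ρ x * (1 + 2 * ts a b x))) := by
  have := lim_param (f := fun (s : ℝ) x => ρ x * (1 + ts a b (x + s • ek k) + ts a b x))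
    (g := fun (s : ℝ) x => ρ x * (1 + ts a b (x + s • ek k) + ts a b x))
    (by have := ts_cont ha hb; fun_prop) (K := tsupport ρ) hs
    (fun s x hx => by simp [image_eq_zero_of_notMem_tsupport hx])
    (fun s _ x => rfl)
  have e : ∫ x, ρ x * (1 + 2 * ts a b x) = ∫ x, ρ x * (1 + ts a b (x + (0:ℝ) • ek k) + ts a b x) := by
    congr 1; funext x; rw [zero_smul, add_zero]; ring
  rw [e]; exact this

lemma II_pt {a b ψ : E2 → ℝ} {M : ℝ} (S : Sol a b ψ M) {ω η ρ : ℝ} {τ s : ℝ} (hω : 0 ≤ ω)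
    (hη : 0 ≤ η) (hρ : 0 ≤ ρ) (hτ : 0 < τ) (hs : 0 < s) (h : ω ^ 2 ≤ η * ρ) (v x : E2) :
    ω * (|dl v (D 0 a) x| + |dl v (ff a b) x|) / s ≤
      τ * (η * ZZ a b v x / s ^ 2) + ρ * (1 + ts a b (x + v) + ts a b x) / (4 * τ) := by
  have hZ := ZZ_nonneg a b v x
  have t1 := ts_nonneg a b x
  have t2 := ts_nonneg a b (x + v)
  apply young (by positivity) (by positivity)
  have c2 := coco2 a b v x
  set y := |dl v (D 0 a) x| + |dl v (ff a b) x| with hy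
  have hy2 : y ^ 2 ≤ (1 + ts a b (x + v) + ts a b x) * ZZ a b v x := by
    refine le_trans ?_ c2
    rw [hy, ← sq_abs (dl v (D 0 a) x), ← sq_abs (dl v (ff a b) x)]
    nlinarith [sq_nonneg (|dl v (D 0 a) x| - |dl v (ff a b) x|)]
  have h2 : ω ^ 2 * y ^ 2 ≤ (η * ρ) * ((1 + ts a b (x + v) + ts a b x) * ZZ a b v x) :=
    mul_le_mul h hy2 (by positivity) (by positivity)
  have e1 : (ω * y / s) ^ 2 = ω ^ 2 * y ^ 2 / s ^ 2 := by ring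
  have e2 : 4 * (τ * (η * ZZ a b v x / s ^ 2)) * (ρ * (1 + ts a b (x + v) + ts a b x) / (4 * τ)) =
      (η * ρ) * ((1 + ts a b (x + v) + ts a b x) * ZZ a b v x) / s ^ 2 := by
    field_simp
  rw [e1, e2]
  gcongr

lemma II_bound {a b ψ : E2 → ℝ} {M : ℝ} (S : Sol a b ψ M) {ω η ρ : E2 → ℝ} {τ s : ℝ}
    (cω : Continuous ω) (sω : HasCompactSupport ω)
    (cη : Continuous η) (sη : HasCompactSupport η) (cρ : Continuous ρ) (sρ : HasCompactSupport ρ)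
    (hω : ∀ x, 0 ≤ ω x) (hη : ∀ x, 0 ≤ η x) (hρ : ∀ x, 0 ≤ ρ x) (hτ : 0 < τ) (hs : 0 < s)
    (h : ∀ x, ω x ^ 2 ≤ η x * ρ x) :
    II a b ω s ≤ 2 * M * (τ * JJ a b η s + ((∫ x, ρ x * (1 + ts a b (x + s • ek 0) + ts a b x)) +
      ∫ x, ρ x * (1 + ts a b (x + s • ek 1) + ts a b x)) / (4 * τ)) := by
  have ca := S.ha.continuous
  have cb := S.hb.continuous
  have d1 : ∀ v, Continuous (dl v (D 0 a)) := dl_cont (D_cont S.ha 0)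
  have d2 : ∀ v, Continuous (dl v (ff a b)) := dl_cont (ff_cont S.ha S.hb)
  have ct := ts_cont S.ha S.hb
  have iZ : ∀ v, Integrable (fun x => η x * ZZ a b v x) := fun v =>
    (cη.mul (ZZ_cont S.ha S.hb v)).integrable_of_hasCompactSupport sη.mul_right
  have iρ : ∀ v, Integrable (fun x => ρ x * (1 + ts a b (x + v) + ts a b x)) := fun v =>
    Continuous.integrable_of_hasCompactSupport (by fun_prop) sρ.mul_right
  have il : Integrable (fun x => -(2 * a x * (dl (s • ek 0) (D 0 a) x + dl (s • ek 1) (ff a b) x) +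
    2 * b x * (dl (s • ek 0) (ff a b) x - dl (s • ek 1) (D 0 a) x)) * ω x / s) := by
    have := d1 (s • ek 0); have := d1 (s • ek 1); have := d2 (s • ek 0); have := d2 (s • ek 1)
    apply Continuous.integrable_of_hasCompactSupport (by fun_prop)
    exact (sω.mul_left).mul_right (f' := fun _ => s⁻¹)
  have ir0 := ((iZ (s • ek 0)).const_mul (2 * M * τ / s ^ 2)).add
    ((iρ (s • ek 0)).const_mul (2 * M / (4 * τ)))
  have ir1 := ((iZ (s • ek 1)).const_mul (2 * M * τ / s ^ 2)).add
    ((iρ (s • ek 1)).const_mul (2 * M / (4 * τ)))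
  have le := integral_mono il (ir0.add ir1) (by
    intro x
    have p0 := II_pt S (hω x) (hη x) (hρ x) hτ hs (h x) (s • ek 0) x
    have p1 := II_pt S (hω x) (hη x) (hρ x) hτ hs (h x) (s • ek 1) x
    have hM0 : 0 ≤ M := by linarith [S.hM]
    have aM := S.aM x
    have bM := S.bM x
    have q : ∀ c z : ℝ, |c| ≤ M → -(c * z) ≤ M * |z| := by
      intro c z hc
      have := neg_abs_le (c * z)
      rw [abs_mul] at this
      have := mul_le_mul_of_nonneg_right hc (abs_nonneg z)
      linarith
    have q1 := q (a x) (dl (s • ek 0) (D 0 a) x) aM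
    have q2 := q (a x) (dl (s • ek 1) (ff a b) x) aM
    have q3 := q (b x) (dl (s • ek 0) (ff a b) x) bM
    have q4 := q (-b x) (dl (s • ek 1) (D 0 a) x) (by rwa [abs_neg])
    have hws : 0 ≤ ω x / s := div_nonneg (hω x) hs.le
    have L1 : -(2 * a x * (dl (s • ek 0) (D 0 a) x + dl (s • ek 1) (ff a b) x) +
      2 * b x * (dl (s • ek 0) (ff a b) x - dl (s • ek 1) (D 0 a) x)) ≤
      2 * M * ((|dl (s • ek 0) (D 0 a) x| + |dl (s • ek 0) (ff a b) x|) +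
       (|dl (s • ek 1) (D 0 a) x| + |dl (s • ek 1) (ff a b) x|)) := by linarith
    have L2 := mul_le_mul_of_nonneg_right L1 hws
    have L3 := mul_le_mul_of_nonneg_left (add_le_add p0 p1) (by linarith : 0 ≤ 2 * M)
    simp only [Pi.add_apply]
    refine le_trans (le_of_eq ?_) (le_trans L2 (le_trans (le_of_eq ?_) (le_trans L3 (le_of_eq ?_))))
    · ring
    · ring
    · ring)
  have e0 := integral_add ir0 ir1
  have e1 := integral_add ((iZ (s • ek 0)).const_mul (2 * M * τ / s ^ 2))
    ((iρ (s • ek 0)).const_mul (2 * M / (4 * τ)))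
  have e2 := integral_add ((iZ (s • ek 1)).const_mul (2 * M * τ / s ^ 2))
    ((iρ (s • ek 1)).const_mul (2 * M / (4 * τ)))
  simp only [Pi.add_apply] at le e0
  rw [e0, e1, e2] at le
  simp only [integral_const_mul] at le
  unfold II JJ
  refine le_trans le (le_of_eq ?_)
  ring

lemma X_bound {a b ψ : E2 → ℝ} {M K : ℝ} (S : Sol a b ψ M) {ω η ρ r : E2 → ℝ}
    (hK : 0 ≤ K) (cω : ContDiff ℝ 1 ω) (sω : HasCompactSupport ω)
    (cη : Continuous η) (sη : HasCompactSupport η) (cρ : Continuous ρ) (sρ : HasCompactSupport ρ)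
    (hω : ∀ x, 0 ≤ ω x) (hη : ∀ x, 0 ≤ η x) (hρ : ∀ x, 0 ≤ ρ x)
    (h : ∀ x, ω x ^ 2 ≤ η x * ρ x) (hr : ∀ x, 0 ≤ r x) (ir : Integrable r)
    (hD : ∀ i x, (D i ω x) ^ 2 ≤ K * ω x * r x) {τ ε : ℝ} (hτ : 0 < τ) (hε : 0 < ε) :
    ∀ᶠ s in 𝓝[>] (0:ℝ), ∫ x, ω x * gr a b x ≤ 4 * M * τ * JJ a b η s +
      2 * M / τ * (∫ x, ρ x * (1 + 2 * ts a b x)) + 8 * M ^ 2 * K * (∫ x, r x) + ε := by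
  have hM0 : 0 ≤ M := by linarith [S.hM]
  have hl := II_lim S.ha S.hb S.hd cω sω
  set X := ∫ x, ω x * gr a b x with hX
  set Y := ∫ x, ((a x * D 0 a x + b x * D 0 b x) * D 0 ω x + (a x * D 1 a x + b x * D 1 b x) * D 1 ω x) with hY
  have ca := S.ha.continuous
  have cb := S.hb.continuous
  have ca0 := D_cont S.ha 0
  have ca1 := D_cont S.ha 1
  have cb0 := D_cont S.hb 0
  have cb1 := D_cont S.hb 1
  have co0 := D_cont cω 0
  have co1 := D_cont cω 1
  have ig : Integrable (fun x => ω x * gr a b x) :=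
    (cω.continuous.mul (gr_cont S.ha S.hb)).integrable_of_hasCompactSupport sω.mul_right
  have hX0 : 0 ≤ X := integral_nonneg (fun x => mul_nonneg (hω x) (gr_nonneg a b x))
  have hYb : - Y ≤ (1/4) * X + 4 * M ^ 2 * K * ∫ x, r x := by
    rw [hY, hX, ← integral_neg, ← integral_const_mul, ← integral_const_mul, ← integral_add
      (ig.const_mul _) (ir.const_mul _)]
    apply integral_mono
    · apply Continuous.integrable_of_hasCompactSupport (by fun_prop)
      exact (((D_hcs sω 0).mul_left).add ((D_hcs sω 1).mul_left)).neg
    · exact (ig.const_mul _).add (ir.const_mul _)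
    · intro x
      have q : ∀ (c d : ℝ) (i : Fin 2), |c| ≤ M → -(c * d * D i ω x) ≤ (1/4) * (ω x * d ^ 2) + M ^ 2 * K * r x := by
        intro c d i hc
        have r0 := hr x
        have w0 := hω x
        apply young (by positivity) (by positivity)
        have h1 : c ^ 2 ≤ M ^ 2 := by
          rw [← sq_abs]; exact pow_le_pow_left₀ (abs_nonneg _) hc 2
        have h2 : c ^ 2 * (D i ω x) ^ 2 ≤ M ^ 2 * (K * ω x * r x) :=
          mul_le_mul h1 (hD i x) (by positivity) (by positivity)
        have h3 := mul_le_mul_of_nonneg_right h2 (sq_nonneg d)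
        nlinarith
      have q1 := q (a x) (D 0 a x) 0 (S.aM x)
      have q2 := q (b x) (D 0 b x) 0 (S.bM x)
      have q3 := q (a x) (D 1 a x) 1 (S.aM x)
      have q4 := q (b x) (D 1 b x) 1 (S.bM x)
      simp only [gr]
      linarith
  have l0 := lim_rho S.ha S.hb cρ sρ 0
  have l1 := lim_rho S.ha S.hb cρ sρ 1
  have l2 := ((l0.add l1).const_mul (M / τ))
  have ev2 := l2.eventually (gt_mem_nhds (lt_add_of_pos_right _ (half_pos hε)))
  have ev1 := hl.eventually (lt_mem_nhds (sub_lt_self _ (by positivity : 0 < ε / 4)))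
  filter_upwards [ev1, ev2, self_mem_nhdsWithin] with s h1 h2 hs
  have hb := II_bound S cω.continuous sω cη sη cρ sρ hω hη hρ hτ hs h
  have e : 2 * M * (τ * JJ a b η s + ((∫ x, ρ x * (1 + ts a b (x + s • ek 0) + ts a b x)) +
      ∫ x, ρ x * (1 + ts a b (x + s • ek 1) + ts a b x)) / (4 * τ)) = 2 * M * τ * JJ a b η s +
      (1/2) * (M / τ * ((∫ x, ρ x * (1 + ts a b (x + s • ek 0) + ts a b x)) +
      ∫ x, ρ x * (1 + ts a b (x + s • ek 1) + ts a b x))) := by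
    field_simp
    ring
  rw [e] at hb
  have e2 : M / τ * ((∫ x, ρ x * (1 + 2 * ts a b x)) + ∫ x, ρ x * (1 + 2 * ts a b x)) =
    2 * M / τ * (∫ x, ρ x * (1 + 2 * ts a b x)) := by ring
  rw [e2] at h2
  linarith

end LPE

open MeasureTheory Real Filter
/-! ## Assembly, given a family of cutoffs -/
namespace LPE
open Topology

lemma stage1 {a b ψ : E2 → ℝ} {M K : ℝ} (S : Sol a b ψ M) {η ζ r : E2 → ℝ} (C : Cut η ζ r K)
    {ε : ℝ} (hε : 0 < ε) :
    ∀ᶠ s in 𝓝[>] (0:ℝ), JJ a b η s ≤ 200 * (1 + K) * M ^ 4 *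
      ((∫ x, ζ x * gr a b x) + 2 * ∫ x, r x) + ε := by
  set c := 200 * (1 + K) * M ^ 4 with hc
  have cζ := C.cζ.continuous
  have l0 := lim_W S.ha S.hb cζ C.sζ 0
  have l1 := lim_W S.ha S.hb cζ C.sζ 1
  have lT := lim_T S.ha S.hb S.hd C.cη.continuous C.sη
  have lim := ((l0.add l1).const_mul c).sub (lT.const_mul 2)
  have eg : (∫ x, ζ x * gr a b x) = (∫ x, ζ x * ((D 0 a x) ^ 2 + (D 0 b x) ^ 2)) +
      ∫ x, ζ x * ((D 1 a x) ^ 2 + (D 1 b x) ^ 2) := by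
    have ca0 := D_cont S.ha 0
    have ca1 := D_cont S.ha 1
    have cb0 := D_cont S.hb 0
    have cb1 := D_cont S.hb 1
    have i0 : Integrable (fun x => ζ x * ((D 0 a x) ^ 2 + (D 0 b x) ^ 2)) :=
      Continuous.integrable_of_hasCompactSupport (by fun_prop) C.sζ.mul_right
    have i1 : Integrable (fun x => ζ x * ((D 1 a x) ^ 2 + (D 1 b x) ^ 2)) :=
      Continuous.integrable_of_hasCompactSupport (by fun_prop) C.sζ.mul_right
    rw [← integral_add i0 i1]
    congr 1; funext x; unfold gr; ring
  rw [← eg] at lim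
  filter_upwards [lim.eventually (gt_mem_nhds (lt_add_of_pos_right _ hε)), self_mem_nhdsWithin] with s h1 hs
  have hs0 : (0:ℝ) < s := hs
  have k0 := stage1_k S C 0 s
  have k1 := stage1_k S C 1 s
  rw [← hc] at k0 k1
  have iT : ∀ v, Integrable (fun x => η x * TT a b v x / s ^ 2) := by
    intro v
    have cα := (dl_contDiff S.ha v).continuous
    have cβ := (dl_contDiff S.hb v).continuous
    have cη := C.cη.continuous
    have := D_cont (av_contDiff S.ha v) 0; have := D_cont (av_contDiff S.ha v) 1
    have := D_cont (av_contDiff S.hb v) 0; have := D_cont (av_contDiff S.hb v) 1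
    apply Continuous.integrable_of_hasCompactSupport
    · unfold TT; fun_prop
    · exact (C.sη.mul_right).mul_right (f' := fun _ => (s ^ 2)⁻¹)
  rw [integral_add (iT _) (iT _)] at h1
  simp only [integral_div] at h1
  unfold JJ
  rw [div_le_iff₀ (by positivity)]
  have h2 : (c * ((∫ x, ζ x * ((dl (s • ek 0) a x) ^ 2 + (dl (s • ek 0) b x) ^ 2)) / s ^ 2 +
      (∫ x, ζ x * ((dl (s • ek 1) a x) ^ 2 + (dl (s • ek 1) b x) ^ 2)) / s ^ 2) -
      2 * ((∫ x, η x * TT a b (s • ek 0) x) / s ^ 2 + (∫ x, η x * TT a b (s • ek 1) x) / s ^ 2)) * s ^ 2 =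
      c * ((∫ x, ζ x * ((dl (s • ek 0) a x) ^ 2 + (dl (s • ek 0) b x) ^ 2)) +
      (∫ x, ζ x * ((dl (s • ek 1) a x) ^ 2 + (dl (s • ek 1) b x) ^ 2))) -
      2 * ((∫ x, η x * TT a b (s • ek 0) x) + (∫ x, η x * TT a b (s • ek 1) x)) := by
    field_simp
  have h3 := mul_le_mul_of_nonneg_right h1.le (sq_nonneg s)
  rw [h2] at h3
  linarith

/-- a family of cutoffs -/
structure Fam (η ζ ρ r ω r2 : ℝ → E2 → ℝ) (K C : ℝ) : Prop where
  hC : 0 ≤ C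
  cut : ∀ L, 1 ≤ L → Cut (η L) (ζ L) (r L) K
  ir : ∀ L, 1 ≤ L → ∫ x, r L x ≤ C / L
  dζ : ∀ L, 1 ≤ L → ∀ i x, (D i (ζ L) x) ^ 2 ≤ K * ζ L x * r L x
  cρ : ∀ L, 1 ≤ L → Continuous (ρ L)
  sρ : ∀ L, 1 ≤ L → HasCompactSupport (ρ L)
  pρ : ∀ L, 1 ≤ L → ∀ x, 0 ≤ ρ L x
  hρ : ∀ L, 1 ≤ L → ∀ x, (ζ L x) ^ 2 ≤ η L x * ρ L x
  hρ2 : ∀ L, 1 ≤ L → ∀ x, (ρ L x) ^ 2 ≤ ζ L x * r L x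
  iρ : ∀ L, 1 ≤ L → ∫ x, ρ L x ≤ C / L
  cω : ∀ L, 1 ≤ L → ContDiff ℝ 1 (ω L)
  sω : ∀ L, 1 ≤ L → HasCompactSupport (ω L)
  pω : ∀ L, 1 ≤ L → ∀ x, 0 ≤ ω L x
  dω : ∀ L, 1 ≤ L → ∀ i x, (D i (ω L) x) ^ 2 ≤ K * ω L x * r2 L x
  pr2 : ∀ L, 1 ≤ L → ∀ x, 0 ≤ r2 L x
  ir2 : ∀ L, 1 ≤ L → Integrable (r2 L)
  ir2' : ∀ L, 1 ≤ L → ∫ x, r2 L x ≤ C / L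
  ωη : ∀ L, 1 ≤ L → ∀ L', 2 * L ≤ L' → ∀ x, (ω L x) ^ 2 ≤ η L' x * ω L x
  mono : ∀ L, 1 ≤ L → ∀ L', 2 * L ≤ L' → ∀ x, ω L x ≤ ω L' x
  pos : ∀ x, ∃ L, 1 ≤ L ∧ 0 < ω L x

variable {η ζ ρ r ω r2 : ℝ → E2 → ℝ} {K C : ℝ}

lemma stage1_full {a b ψ : E2 → ℝ} {M : ℝ} (S : Sol a b ψ M) (F : Fam η ζ ρ r ω r2 K C) :
    ∃ C' : ℝ, 0 ≤ C' ∧ ∀ L, 1 ≤ L → ∀ᶠ s in 𝓝[>] (0:ℝ), JJ a b (η L) s ≤ C' / L := by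
  have hM := S.hM
  have hM0 : 0 < M := by linarith
  have hK : 0 ≤ K := (F.cut 1 le_rfl).hK
  have hC := F.hC
  set c1 := 200 * (1 + K) * M ^ 4 with hc1
  have hc1p : 0 < c1 := by positivity
  obtain ⟨δ, hδd⟩ : ∃ δ, δ = 1 / (16 * M * c1) := ⟨_, rfl⟩
  have hδ : 0 < δ := by rw [hδd]; positivity
  have hδe : c1 * (8 * M * δ) = 1 / 2 := by rw [hδd]; field_simp; norm_num
  obtain ⟨κ, hκd⟩ : ∃ κ, κ = δ / (16 * M) := ⟨_, rfl⟩
  have hκ : 0 < κ := by rw [hκd]; positivity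
  have hκe : 2 * M / δ * (4 * κ) = 1 / 2 := by rw [hκd]; field_simp; norm_num
  set B := 2 * M / δ * (1 + 1 / (2 * κ)) with hB
  have hBp : 0 ≤ B := by positivity
  refine ⟨2 * (c1 * (2 * B * C + 16 * M ^ 2 * K * C + 2) + 2 * c1 * C + 1), by positivity, ?_⟩
  intro L hL
  have hL0 : 0 < L := by linarith
  have cut := F.cut L hL
  have hε : 0 < 1 / L := by positivity
  have s1 := stage1 S cut hε
  have s2 := X_bound S hK cut.cζ cut.sζ cut.cη.continuous cut.sη (F.cρ L hL) (F.sρ L hL) cut.pζ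
    cut.pη (F.pρ L hL) (F.hρ L hL) cut.pr cut.ir (F.dζ L hL) hδ hε
  filter_upwards [s1, s2] with s h1 h2
  set X := ∫ x, ζ L x * gr a b x with hX
  set J := JJ a b (η L) s
  have ct := ts_cont S.ha S.hb
  have cρ := F.cρ L hL
  have ig : Integrable (fun x => ζ L x * gr a b x) :=
    (cut.cζ.continuous.mul (gr_cont S.ha S.hb)).integrable_of_hasCompactSupport cut.sζ.mul_right
  have iρ : Integrable (ρ L) := cρ.integrable_of_hasCompactSupport (F.sρ L hL)
  have h3 : ∫ x, ρ L x * (1 + 2 * ts a b x) ≤ (∫ x, ρ L x) + (4 * κ * X + 1 / (2 * κ) * ∫ x, r L x) := by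
    have iq : Integrable (fun x => 4 * κ * (ζ L x * gr a b x) + 1 / (2 * κ) * r L x) :=
      (ig.const_mul _).add (cut.ir.const_mul _)
    rw [hX, ← integral_const_mul, ← integral_const_mul,
      ← integral_add (ig.const_mul _) (cut.ir.const_mul _),
      ← integral_add iρ iq]
    apply integral_mono
    · exact Continuous.integrable_of_hasCompactSupport (by fun_prop) (F.sρ L hL).mul_right
    · exact iρ.add iq
    · intro x
      have z0 := cut.pζ x
      have r0 := cut.pr x
      have p0 := F.pρ L hL x
      have t0 := ts_nonneg a b x
      have t2 := ts_sq a b x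
      have y : ρ L x * ts a b x ≤ κ * (ζ L x * (ts a b x) ^ 2) + r L x / (4 * κ) := by
        apply young (by positivity) (by positivity)
        have := mul_le_mul_of_nonneg_right (F.hρ2 L hL x) (sq_nonneg (ts a b x))
        have e : 4 * (κ * (ζ L x * ts a b x ^ 2)) * (r L x / (4 * κ)) = ζ L x * r L x * ts a b x ^ 2 := by
          field_simp
        rw [e, mul_pow]; exact this
      have y2 : κ * (ζ L x * (ts a b x) ^ 2) ≤ κ * (ζ L x * (2 * gr a b x)) := by gcongr
      have e2 : r L x / (4 * κ) = (1/2) * (1 / (2 * κ) * r L x) := by field_simp; norm_num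
      simp only
      rw [e2] at y
      linarith
  have hr := F.ir L hL
  have hρi := F.iρ L hL
  have h4 : 2 * M / δ * (∫ x, ρ L x * (1 + 2 * ts a b x)) ≤ (1/2) * X + B * (C / L) := by
    have q := mul_le_mul_of_nonneg_left h3 (by positivity : 0 ≤ 2 * M / δ)
    have q2 : (∫ x, ρ L x) + 1 / (2 * κ) * ∫ x, r L x ≤ (1 + 1 / (2 * κ)) * (C / L) := by
      have := mul_le_mul_of_nonneg_left hr (by positivity : 0 ≤ 1 / (2 * κ))
      linarith
    have q3 := mul_le_mul_of_nonneg_left q2 (by positivity : 0 ≤ 2 * M / δ)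
    have q4 : 2 * M / δ * (4 * κ) * X = 1 / 2 * X := by rw [hκe]
    rw [hB]
    linarith
  have h5 : 8 * M ^ 2 * K * (∫ x, r L x) ≤ 8 * M ^ 2 * K * (C / L) :=
    mul_le_mul_of_nonneg_left hr (by positivity)
  have h6 : X ≤ 8 * M * δ * J + (2 * B * (C / L) + 16 * M ^ 2 * K * (C / L) + 2 * (1 / L)) := by linarith
  have h7 := mul_le_mul_of_nonneg_left h6 hc1p.le
  have h8 : c1 * (8 * M * δ * J) = 1 / 2 * J := by rw [← hδe]; ring
  have h9 := mul_le_mul_of_nonneg_left hr hc1p.le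
  have e : 2 * (c1 * (2 * B * C + 16 * M ^ 2 * K * C + 2) + 2 * c1 * C + 1) / L =
    2 * (c1 * (2 * B * (C / L) + 16 * M ^ 2 * K * (C / L) + 2 * (1 / L)) + 2 * (c1 * (C / L)) + 1 / L) := by
    ring
  rw [e]
  linarith

lemma stage2 {a b ψ : E2 → ℝ} {M : ℝ} (S : Sol a b ψ M) (F : Fam η ζ ρ r ω r2 K C) {L : ℝ} (hL : 1 ≤ L) :
    ∫ x, ω L x * gr a b x ≤ 8 * M ^ 2 * K * C / L := by
  have hM := S.hM
  have hM0 : 0 < M := by linarith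
  have hK : 0 ≤ K := (F.cut 1 le_rfl).hK
  obtain ⟨C', hC', hJ⟩ := stage1_full S F
  apply le_of_forall_pos_le_add
  intro ε hε
  set N := ∫ x, ω L x * (1 + 2 * ts a b x) with hN
  have hN0 : 0 ≤ N := integral_nonneg (fun x => mul_nonneg (F.pω L hL x)
    (by have := ts_nonneg a b x; positivity))
  obtain ⟨τ, hτd⟩ : ∃ τ, τ = 6 * M * (N + 1) / ε := ⟨_, rfl⟩
  have hτ : 0 < τ := by rw [hτd]; positivity
  have hτN : 2 * M / τ * N ≤ ε / 3 := by
    rw [hτd]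
    have : 2 * M / (6 * M * (N + 1) / ε) * N = ε / 3 * (N / (N + 1)) := by field_simp; ring
    rw [this]
    have h1 : N / (N + 1) ≤ 1 := by rw [div_le_one (by positivity)]; linarith
    nlinarith
  obtain ⟨L', hLd⟩ : ∃ L', L' = 2 * L + 12 * M * τ * C' / ε := ⟨_, rfl⟩
  have hL2 : 2 * L ≤ L' := by
    rw [hLd]; have : 0 ≤ 12 * M * τ * C' / ε := by positivity
    linarith
  have hL1 : 1 ≤ L' := by linarith
  have hL0 : 0 < L' := by linarith
  have hq : 4 * M * τ * (C' / L') ≤ ε / 3 := by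
    have : 12 * M * τ * C' / ε ≤ L' := by rw [hLd]; linarith
    rw [div_le_iff₀ hε] at this
    have e : 4 * M * τ * (C' / L') = (4 * M * τ * C') / L' := by ring
    rw [e, div_le_iff₀ hL0]
    linarith
  have cut := F.cut L' hL1
  have ev := X_bound S hK (F.cω L hL) (F.sω L hL) cut.cη.continuous cut.sη (F.cω L hL).continuous
    (F.sω L hL) (F.pω L hL) cut.pη (F.pω L hL) (F.ωη L hL L' hL2) (F.pr2 L hL) (F.ir2 L hL)
    (F.dω L hL) hτ (by positivity : 0 < ε / 3)
  obtain ⟨s, h1, h2⟩ := (ev.and (hJ L' hL1)).exists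
  have h3 := mul_le_mul_of_nonneg_left h2 (by positivity : 0 ≤ 4 * M * τ)
  have h4 := mul_le_mul_of_nonneg_left (F.ir2' L hL) (by positivity : 0 ≤ 8 * M ^ 2 * K)
  have e : 8 * M ^ 2 * K * C / L = 8 * M ^ 2 * K * (C / L) := by ring
  rw [e]
  linarith

lemma grad_zero {a b ψ : E2 → ℝ} {M : ℝ} (S : Sol a b ψ M) (F : Fam η ζ ρ r ω r2 K C) (x : E2) :
    gr a b x = 0 := by
  obtain ⟨L, hL, hpos⟩ := F.pos x
  have hK : 0 ≤ K := (F.cut 1 le_rfl).hK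
  have hC := F.hC
  have hM0 : 0 ≤ M := by linarith [S.hM]
  have ig : ∀ L, 1 ≤ L → Integrable (fun x => ω L x * gr a b x) := fun L hL =>
    ((F.cω L hL).continuous.mul (gr_cont S.ha S.hb)).integrable_of_hasCompactSupport (F.sω L hL).mul_right
  have hnn : ∀ y, 0 ≤ ω L y * gr a b y := fun y => mul_nonneg (F.pω L hL y) (gr_nonneg a b y)
  have le0 : ∫ y, ω L y * gr a b y ≤ 0 := by
    apply le_of_forall_pos_le_add
    intro ε hε
    obtain ⟨L', hLd⟩ : ∃ L', L' = 2 * L + 8 * M ^ 2 * K * C / ε := ⟨_, rfl⟩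
    have hL2 : 2 * L ≤ L' := by
      rw [hLd]; have : 0 ≤ 8 * M ^ 2 * K * C / ε := by positivity
      linarith
    have hL1 : 1 ≤ L' := by linarith
    have h1 : ∫ y, ω L y * gr a b y ≤ ∫ y, ω L' y * gr a b y :=
      integral_mono (ig L hL) (ig L' hL1) (fun y =>
        mul_le_mul_of_nonneg_right (F.mono L hL L' hL2 y) (gr_nonneg a b y))
    have h2 := stage2 S F hL1
    have h3 : 8 * M ^ 2 * K * C / L' ≤ ε := by
      have : 8 * M ^ 2 * K * C / ε ≤ L' := by rw [hLd]; linarith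
      rw [div_le_iff₀ hε] at this
      rw [div_le_iff₀ (by linarith)]
      linarith
    linarith
  have z := (integral_eq_zero_iff_of_nonneg hnn (ig L hL)).1 (le_antisymm le0 (integral_nonneg hnn))
  have cc : Continuous (fun y => ω L y * gr a b y) := (F.cω L hL).continuous.mul (gr_cont S.ha S.hb)
  have z2 := (Continuous.ae_eq_iff_eq volume cc continuous_const).1 z
  have z3 : ω L x * gr a b x = 0 := congrFun z2 x
  rcases mul_eq_zero.1 z3 with h | h
  · linarith
  · exact h

lemma const_of_gr {a b : E2 → ℝ} (ha : ContDiff ℝ 1 a) (hb : ContDiff ℝ 1 b) (h : ∀ x, gr a b x = 0)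
    (x : E2) : a x = a 0 ∧ b x = b 0 := by
  have key : ∀ x, D 0 a x = 0 ∧ D 0 b x = 0 ∧ D 1 a x = 0 ∧ D 1 b x = 0 := by
    intro x
    have := h x
    unfold gr at this
    refine ⟨?_, ?_, ?_, ?_⟩ <;> apply pow_eq_zero_iff (two_ne_zero) |>.1 <;>
      nlinarith [sq_nonneg (D 0 a x), sq_nonneg (D 0 b x), sq_nonneg (D 1 a x), sq_nonneg (D 1 b x)]
  have fa : ∀ x, fderiv ℝ a x = 0 := by
    intro x; ext v; rw [fderiv_decomp, (key x).1, (key x).2.2.1]; simp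
  have fb : ∀ x, fderiv ℝ b x = 0 := by
    intro x; ext v; rw [fderiv_decomp, (key x).2.1, (key x).2.2.2]; simp
  exact ⟨is_const_of_fderiv_eq_zero (diff_of ha) fa x 0, is_const_of_fderiv_eq_zero (diff_of hb) fb x 0⟩

end LPE

open MeasureTheory Real Filter
/-! ## The logarithmic cutoffs -/
namespace LPE
open Topology

/-- the logarithm of the regularised radius -/
def lg (x : E2) : ℝ := Real.log (1 + ((x 0) ^ 2 + (x 1) ^ 2)) / 2

/-- inverse of the regularised radius -/
def ei (x : E2) : ℝ := Real.exp (- lg x)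

lemma co_contDiff {n : WithTop ℕ∞} (k : Fin 2) : ContDiff ℝ n (fun x : E2 => x k) :=
  contDiff_euclidean.1 contDiff_id k

lemma PP_pos (x : E2) : 0 < 1 + ((x 0) ^ 2 + (x 1) ^ 2) := by positivity

lemma lg_contDiff {n : WithTop ℕ∞} : ContDiff ℝ n lg := by
  unfold lg
  have h0 := co_contDiff (n := n) 0
  have h1 := co_contDiff (n := n) 1
  exact ((contDiff_const.add ((h0.pow 2).add (h1.pow 2))).log (fun x => (PP_pos x).ne')).div_const _

lemma ei_contDiff {n : WithTop ℕ∞} : ContDiff ℝ n ei := by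
  unfold ei; exact (lg_contDiff.neg).exp

lemma ei_pos (x : E2) : 0 < ei x := Real.exp_pos _

lemma lg_nonneg (x : E2) : 0 ≤ lg x := by
  unfold lg
  have : 0 ≤ Real.log (1 + ((x 0) ^ 2 + (x 1) ^ 2)) := Real.log_nonneg (by nlinarith [sq_nonneg (x 0), sq_nonneg (x 1)])
  positivity

lemma ei_le (x : E2) : ei x ≤ 1 := by
  unfold ei; rw [Real.exp_le_one_iff]; linarith [lg_nonneg x]

lemma ei_sq (x : E2) : (ei x) ^ 2 * (1 + ((x 0) ^ 2 + (x 1) ^ 2)) = 1 := by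
  have h : (ei x) ^ 2 = (1 + ((x 0) ^ 2 + (x 1) ^ 2))⁻¹ := by
    unfold ei lg
    rw [← Real.exp_nat_mul, ← Real.exp_log (PP_pos x), ← Real.exp_neg, Real.exp_log (PP_pos x)]
    congr 1; push_cast; ring
  rw [h]; exact inv_mul_cancel₀ (PP_pos x).ne'

lemma D_co (i k : Fin 2) (x : E2) : D i (fun y : E2 => y k) x = if i = k then 1 else 0 := by
  unfold D
  have h : (fun y : E2 => y k) = (EuclideanSpace.proj k : E2 →L[ℝ] ℝ) := by funext y; simp
  rw [h, ContinuousLinearMap.fderiv]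
  fin_cases i <;> fin_cases k <;> simp [ek]

lemma D_ei (i : Fin 2) (x : E2) : D i ei x = - (ei x * D i lg x) := by
  have h := D_comp (f := fun y => - lg y) (g := Real.exp) (diff_of lg_contDiff.neg) Real.differentiable_exp i x
  unfold ei
  rw [h, D_neg (diff_of lg_contDiff)]; simp

lemma D_lg (i : Fin 2) (x : E2) : D i lg x = x i * (ei x) ^ 2 := by
  have h1 : (fun y => Real.exp (2 * lg y)) = fun y : E2 => (1 + (y 0 * y 0 + y 1 * y 1)) := by
    funext y; unfold lg
    rw [mul_div_cancel₀ _ (two_ne_zero), Real.exp_log (PP_pos y)]; ring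
  have hl := diff_of (lg_contDiff)
  have h2 := D_comp (f := fun y => 2 * lg y) (g := Real.exp) (hl.const_mul 2) Real.differentiable_exp i x
  have d0 := diff_of (co_contDiff (n := 1) 0)
  have d1 := diff_of (co_contDiff (n := 1) 1)
  have m0 : Differentiable ℝ (fun y : E2 => y 0 * y 0) := d0.mul d0
  have m1 : Differentiable ℝ (fun y : E2 => y 1 * y 1) := d1.mul d1
  have m2 : Differentiable ℝ (fun y : E2 => y 0 * y 0 + y 1 * y 1) := m0.add m1
  rw [h1, D_const_mul hl, D_add (differentiable_const _) m2, D_add m0 m1, D_mul d0 d0, D_mul d1 d1, D_co, D_co] at h2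
  have h3 : D i (fun _ : E2 => (1:ℝ)) x = 0 := by simp [D]
  have h4 : (ei x) ^ 2 * Real.exp (2 * lg x) = 1 := by
    unfold ei; rw [← Real.exp_nat_mul, ← Real.exp_add]; simp
  rw [h3] at h2
  simp only [Real.deriv_exp] at h2
  have h5 : x i = Real.exp (2 * lg x) * D i lg x := by
    fin_cases i <;> simp at h2 ⊢ <;> linarith
  calc D i lg x = ((ei x) ^ 2 * Real.exp (2 * lg x)) * D i lg x := by rw [h4]; ring
    _ = (Real.exp (2 * lg x) * D i lg x) * (ei x) ^ 2 := by ring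
    _ = _ := by rw [← h5]

lemma xe_le (i : Fin 2) (x : E2) : |x i * ei x| ≤ 1 := by
  have h := ei_sq x
  rw [← sq_le_one_iff_abs_le_one]
  have : 0 ≤ (ei x) ^ 2 := sq_nonneg _
  rw [mul_pow]
  fin_cases i <;> simp only [Fin.zero_eta, Fin.mk_one] <;> nlinarith [mul_nonneg this (sq_nonneg (x 0)), mul_nonneg this (sq_nonneg (x 1))]

lemma D_lg_le (i : Fin 2) (x : E2) : |D i lg x| ≤ ei x := by
  rw [D_lg]
  have h := xe_le i x
  have e : x i * ei x ^ 2 = (x i * ei x) * ei x := by ring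
  rw [e, abs_mul, abs_of_pos (ei_pos x)]
  nlinarith [ei_pos x]

lemma DD_lg_le (i j : Fin 2) (x : E2) : |D i (D j lg) x| ≤ 3 * ei x ^ 2 := by
  have h : D j lg = fun y => y j * (ei y * ei y) := by funext y; rw [D_lg]; ring
  have de := diff_of ei_contDiff
  have de2 : Differentiable ℝ (fun y => ei y * ei y) := de.mul de
  rw [h, D_mul (diff_of (co_contDiff j)) de2, D_mul de de, D_co, D_ei]
  have hx := xe_le j x
  have hl := D_lg_le i x
  have e0 := ei_pos x
  have e : x j * (ei x * -(ei x * D i lg x) + -(ei x * D i lg x) * ei x) =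
    -(2 * ei x) * ((x j * ei x) * D i lg x) := by ring
  rw [e]
  have k1 : |(x j * ei x) * D i lg x| ≤ ei x := by
    rw [abs_mul]; nlinarith [abs_nonneg (x j * ei x), abs_nonneg (D i lg x)]
  have k2 : |-(2 * ei x) * ((x j * ei x) * D i lg x)| ≤ 2 * ei x ^ 2 := by
    rw [abs_mul, abs_neg, abs_of_pos (by positivity : 0 < 2 * ei x)]; nlinarith
  have k3 : |(if i = j then (1:ℝ) else 0) * (ei x * ei x)| ≤ ei x ^ 2 := by
    split_ifs
    · rw [one_mul, abs_of_pos (by positivity)]; nlinarith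
    · simp; positivity
  refine (abs_add_le _ _).trans ?_
  linarith

/-- one-dimensional cutoff -/
def sg (t : ℝ) : ℝ := Real.smoothTransition (2 - t)

lemma sg_contDiff {n : ℕ∞} : ContDiff ℝ n sg :=
  (Real.smoothTransition.contDiff (n := n)).comp (contDiff_const.sub contDiff_id)

lemma sg_one {t : ℝ} (h : t ≤ 1) : sg t = 1 := Real.smoothTransition.one_of_one_le (by linarith)
lemma sg_zero {t : ℝ} (h : 2 ≤ t) : sg t = 0 := Real.smoothTransition.zero_of_nonpos (by linarith)
lemma sg_nonneg (t : ℝ) : 0 ≤ sg t := Real.smoothTransition.nonneg _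
lemma sg_le (t : ℝ) : sg t ≤ 1 := Real.smoothTransition.le_one _

lemma sg_bounds : ∃ B : ℝ, 1 ≤ B ∧ (∀ t, |deriv sg t| ≤ B) ∧ ∀ t, |deriv (deriv sg) t| ≤ B := by
  have s1 : HasCompactSupport (deriv sg) := by
    apply HasCompactSupport.intro (isCompact_Icc (a := (1:ℝ)) (b := 2))
    intro t ht
    rcases lt_or_ge t 1 with h | h
    · have : sg =ᶠ[𝓝 t] fun _ => 1 := by
        filter_upwards [gt_mem_nhds h] with y hy using sg_one hy.le
      rw [this.deriv_eq]; simp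
    · have h2 : 2 < t := by
        by_contra h3; exact ht ⟨h, not_lt.1 h3⟩
      have : sg =ᶠ[𝓝 t] fun _ => 0 := by
        filter_upwards [lt_mem_nhds h2] with y hy using sg_zero hy.le
      rw [this.deriv_eq]; simp
  have c2 : ContDiff ℝ 2 sg := sg_contDiff (n := 2)
  have c1 : ContDiff ℝ 1 (deriv sg) := ContDiff.deriv' (by rw [one_add_one_eq_two]; exact c2)
  obtain ⟨B1, h1⟩ := s1.exists_bound_of_continuous c1.continuous
  obtain ⟨B2, h2⟩ := s1.deriv.exists_bound_of_continuous (c1.continuous_deriv le_rfl)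
  refine ⟨max 1 (max B1 B2), le_max_left _ _, fun t => ?_, fun t => ?_⟩
  · exact (h1 t).trans ((le_max_left _ _).trans (le_max_right _ _))
  · exact (h2 t).trans ((le_max_right _ _).trans (le_max_right _ _))

/-- the logarithmic cutoff -/
def th (L : ℝ) (x : E2) : ℝ := sg (L⁻¹ * lg x)

lemma th_contDiff (L : ℝ) : ContDiff ℝ 2 (th L) := by
  unfold th
  exact (sg_contDiff (n := 2)).comp (contDiff_const.mul lg_contDiff)

lemma th_nonneg (L : ℝ) (x : E2) : 0 ≤ th L x := sg_nonneg _
lemma th_le (L : ℝ) (x : E2) : th L x ≤ 1 := sg_le _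

lemma normsq (x : E2) : ‖x‖ ^ 2 = (x 0) ^ 2 + (x 1) ^ 2 := by
  rw [EuclideanSpace.real_norm_sq_eq, Fin.sum_univ_two]

lemma norm_le_exp (x : E2) : ‖x‖ ≤ Real.exp (lg x) := by
  have h : Real.exp (lg x) ^ 2 = 1 + ‖x‖ ^ 2 := by
    rw [normsq]; unfold lg
    rw [← Real.exp_nat_mul]; push_cast
    rw [mul_div_cancel₀ _ (two_ne_zero), Real.exp_log (PP_pos x)]
  exact abs_le_of_sq_le_sq' (by linarith) (Real.exp_pos _).le |>.2

lemma th_zero {L : ℝ} (hL : 1 ≤ L) {x : E2} (hx : x ∉ Metric.closedBall (0:E2) (Real.exp (2 * L))) :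
    th L x = 0 := by
  apply sg_zero
  rw [Metric.mem_closedBall, dist_zero_right, not_le] at hx
  have := (Real.exp_lt_exp.1 (hx.trans_le (norm_le_exp x))).le
  rw [inv_mul_eq_div, le_div_iff₀ (by linarith)]
  exact this

lemma th_hcs {L : ℝ} (hL : 1 ≤ L) : HasCompactSupport (th L) :=
  HasCompactSupport.intro (isCompact_closedBall _ _) (fun _ hx => th_zero hL hx)

lemma D_th (L : ℝ) (i : Fin 2) (x : E2) : D i (th L) x = deriv sg (L⁻¹ * lg x) * (L⁻¹ * D i lg x) := by
  have hl := diff_of lg_contDiff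
  have := D_comp (f := fun y => L⁻¹ * lg y) (g := sg) (hl.const_mul _)
    ((sg_contDiff (n := 1)).differentiable (by simp)) i x
  rw [D_const_mul hl] at this
  exact this

lemma th_mono {L L' : ℝ} (hL : 1 ≤ L) (h : 2 * L ≤ L') (x : E2) : th L x = 0 ∨ th L' x = 1 := by
  by_cases hx : 2 * L ≤ lg x
  · left; apply sg_zero; rw [inv_mul_eq_div, le_div_iff₀ (by linarith)]; exact hx
  · right; apply sg_one; rw [inv_mul_eq_div, div_le_one (by linarith)]; linarith

lemma th_bounds {B : ℝ} (hB : 1 ≤ B) (h1 : ∀ t, |deriv sg t| ≤ B) (h2 : ∀ t, |deriv (deriv sg) t| ≤ B)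
    {L : ℝ} (hL : 1 ≤ L) (i j : Fin 2) (x : E2) :
    |D i (th L) x| ≤ B * (L⁻¹ * ei x) ∧ |D i (D j (th L)) x| ≤ 4 * B * (L⁻¹ * ei x * ei x) := by
  have hL0 : 0 < L⁻¹ := by positivity
  have hL1 : L⁻¹ ≤ 1 := inv_le_one_of_one_le₀ hL
  have e0 := ei_pos x
  have hl := diff_of lg_contDiff
  have c2 : ContDiff ℝ 2 sg := sg_contDiff (n := 2)
  have c1 : ContDiff ℝ 1 (deriv sg) := ContDiff.deriv' (by rw [one_add_one_eq_two]; exact c2)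
  have k : ∀ i, |L⁻¹ * D i lg x| ≤ L⁻¹ * ei x := by
    intro i; rw [abs_mul, abs_of_pos hL0]
    exact mul_le_mul_of_nonneg_left (D_lg_le i x) hL0.le
  constructor
  · rw [D_th, abs_mul]
    exact mul_le_mul (h1 _) (k i) (abs_nonneg _) (by linarith)
  · have e : D j (th L) = fun y => deriv sg (L⁻¹ * lg y) * (L⁻¹ * D j lg y) := by
      funext y; exact D_th L j y
    have dd := diff_of (D_contDiff lg_contDiff j)
    have dc : Differentiable ℝ (fun y => deriv sg (L⁻¹ * lg y)) :=
      (c1.differentiable one_ne_zero).comp (hl.const_mul _)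
    rw [e, D_mul dc (dd.const_mul _), D_const_mul dd,
      D_comp (f := fun y => L⁻¹ * lg y) (g := deriv sg) (hl.const_mul _) (c1.differentiable one_ne_zero),
      D_const_mul hl]
    have q1 : |deriv sg (L⁻¹ * lg x) * (L⁻¹ * D i (D j lg) x)| ≤ B * (L⁻¹ * (3 * ei x ^ 2)) := by
      rw [abs_mul, abs_mul, abs_of_pos hL0]
      have := DD_lg_le i j x
      have := h1 (L⁻¹ * lg x)
      gcongr
    have q2 : |deriv (deriv sg) (L⁻¹ * lg x) * (L⁻¹ * D i lg x) * (L⁻¹ * D j lg x)| ≤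
        B * (L⁻¹ * ei x) * (L⁻¹ * ei x) := by
      rw [abs_mul, abs_mul]
      have := h2 (L⁻¹ * lg x)
      have := k i
      have := k j
      gcongr
    have q3 : B * (L⁻¹ * ei x) * (L⁻¹ * ei x) ≤ B * (L⁻¹ * ei x) * (1 * ei x) := by gcongr
    refine (abs_add_le _ _).trans ?_
    have q4 : 4 * B * (L⁻¹ * ei x * ei x) = B * (L⁻¹ * (3 * ei x ^ 2)) + B * (L⁻¹ * ei x) * (1 * ei x) := by ring
    rw [q4]
    exact add_le_add q1 (q2.trans q3)

end LPE

open MeasureTheory Real Filter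
/-! ## The family of cutoffs, and integrals -/
namespace LPE
open Topology

lemma D_pow {f : E2 → ℝ} (hf : Differentiable ℝ f) (n : ℕ) (k : Fin 2) (x : E2) :
    D k (fun y => f y ^ n) x = n * f x ^ (n - 1) * D k f x := by
  have := D_comp (f := f) (g := fun t => t ^ n) hf (by fun_prop) k x
  rw [this]; simp

lemma ei_eq_rpow (x : E2) : ei x ^ 3 = (1 + ‖x‖ ^ 2) ^ (-(3:ℝ) / 2) := by
  rw [normsq, Real.rpow_def_of_pos (PP_pos x)]
  unfold ei lg
  rw [← Real.exp_nat_mul]; congr 1; push_cast; ring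

lemma ei3_int : Integrable (fun x => ei x ^ 3) := by
  have h := integrable_rpow_neg_one_add_norm_sq (E := E2) (μ := volume) (r := 3) (by simp; norm_num)
  refine h.congr (Eventually.of_forall fun x => ?_)
  simp only; rw [ei_eq_rpow]

lemma one_dim {R : ℝ} (hR : 0 ≤ R) : ∫ y in Set.Ioc 0 R, y * (1 + y ^ 2)⁻¹ = Real.log (1 + R ^ 2) / 2 := by
  rw [← intervalIntegral.integral_of_le hR]
  have hd : ∀ y : ℝ, HasDerivAt (fun y => Real.log (1 + y ^ 2) / 2) (y * (1 + y ^ 2)⁻¹) y := by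
    intro y
    have h1 : HasDerivAt (fun y : ℝ => 1 + y ^ 2) (2 * y) y := by
      have := (hasDerivAt_pow 2 y).const_add 1
      simpa using this
    have h2 := (h1.log (by positivity)).div_const 2
    have e : y * (1 + y ^ 2)⁻¹ = 2 * y / (1 + y ^ 2) / 2 := by ring
    rw [e]; exact h2
  have hc : Continuous (fun y : ℝ => y * (1 + y ^ 2)⁻¹) :=
    continuous_id.mul ((by fun_prop : Continuous (fun y : ℝ => 1 + y ^ 2)).inv₀ (fun y => by positivity))
  rw [intervalIntegral.integral_eq_sub_of_hasDerivAt (fun y _ => hd y) (hc.intervalIntegrable _ _)]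
  simp

lemma ball_int {R : ℝ} (hR : 0 ≤ R) :
    ∫ x, (Metric.closedBall (0:E2) R).indicator (fun x => ei x ^ 2) x =
      volume.real (Metric.ball (0:E2) 1) * Real.log (1 + R ^ 2) := by
  have h1 : ∀ x : E2, (Metric.closedBall (0:E2) R).indicator (fun x => ei x ^ 2) x =
      (Set.Iic R).indicator (fun t => (1 + t ^ 2)⁻¹) ‖x‖ := by
    intro x
    have e : ei x ^ 2 = (1 + ‖x‖ ^ 2)⁻¹ := by
      rw [normsq]; exact eq_inv_of_mul_eq_one_left (ei_sq x)
    by_cases hx : ‖x‖ ≤ R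
    · rw [Set.indicator_of_mem (by simpa using hx), Set.indicator_of_mem (by simpa using hx), e]
    · rw [Set.indicator_of_notMem (by simpa using hx), Set.indicator_of_notMem (by simpa using hx)]
  simp only [h1]
  rw [integral_fun_norm_addHaar volume (fun t => (Set.Iic R).indicator (fun t => (1 + t ^ 2)⁻¹) t)]
  have h2 : ∫ y in Set.Ioi (0:ℝ), y ^ (Module.finrank ℝ E2 - 1) •
      (Set.Iic R).indicator (fun t => (1 + t ^ 2)⁻¹) y = Real.log (1 + R ^ 2) / 2 := by
    rw [← one_dim hR]
    have e : ∀ y : ℝ, y ^ (Module.finrank ℝ E2 - 1) • (Set.Iic R).indicator (fun t => (1 + t ^ 2)⁻¹) y =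
        (Set.Iic R).indicator (fun t => t * (1 + t ^ 2)⁻¹) y := by
      intro y
      by_cases hy : y ≤ R
      · rw [Set.indicator_of_mem (by simpa using hy), Set.indicator_of_mem (by simpa using hy)]; simp
      · rw [Set.indicator_of_notMem (by simpa using hy), Set.indicator_of_notMem (by simpa using hy)]; simp
    simp only [e]
    rw [setIntegral_indicator measurableSet_Iic, Set.Ioi_inter_Iic]
  rw [h2]
  simp; ring

/-- remainder weight -/
def rr2 (L : ℝ) (x : E2) : ℝ := (Metric.closedBall (0:E2) (Real.exp (2 * L))).indicator (fun x => (L⁻¹ * ei x) ^ 2) x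

lemma rr2_nonneg (L : ℝ) (x : E2) : 0 ≤ rr2 L x := Set.indicator_nonneg (fun _ _ => sq_nonneg _) _

lemma rr2_int (L : ℝ) : Integrable (rr2 L) := by
  unfold rr2
  rw [integrable_indicator_iff measurableSet_closedBall]
  have : Continuous (fun x => (L⁻¹ * ei x) ^ 2) := (continuous_const.mul (ei_contDiff (n := 1)).continuous).pow 2
  exact this.continuousOn.integrableOn_compact (isCompact_closedBall _ _)

lemma rr2_le {L : ℝ} (hL : 1 ≤ L) : ∫ x, rr2 L x ≤ 5 * volume.real (Metric.ball (0:E2) 1) / L := by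
  have hL0 : 0 < L := by linarith
  have e : ∀ x, rr2 L x = (L⁻¹) ^ 2 * (Metric.closedBall (0:E2) (Real.exp (2 * L))).indicator (fun x => ei x ^ 2) x := by
    intro x; unfold rr2
    by_cases hx : x ∈ Metric.closedBall (0:E2) (Real.exp (2 * L))
    · rw [Set.indicator_of_mem hx, Set.indicator_of_mem hx]; ring
    · rw [Set.indicator_of_notMem hx, Set.indicator_of_notMem hx]; ring
  simp only [e]
  rw [integral_const_mul, ball_int (Real.exp_pos _).le]
  set V := volume.real (Metric.ball (0:E2) 1)
  have hV : 0 ≤ V := measureReal_nonneg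
  have h1 : Real.log (1 + Real.exp (2 * L) ^ 2) ≤ 5 * L := by
    rw [Real.log_le_iff_le_exp (by positivity), ← Real.exp_nat_mul]
    have e2 : Real.exp (5 * L) = Real.exp L * Real.exp (4 * L) := by rw [← Real.exp_add]; ring_nf
    have e3 : ((2:ℕ):ℝ) * (2 * L) = 4 * L := by push_cast; ring
    rw [e2, e3]
    have k1 := Real.add_one_le_exp L
    have k2 := Real.add_one_le_exp (4 * L)
    nlinarith
  calc (L⁻¹) ^ 2 * (V * Real.log (1 + Real.exp (2 * L) ^ 2)) ≤ (L⁻¹) ^ 2 * (V * (5 * L)) := by gcongr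
    _ = 5 * V / L := by field_simp

/-- pointwise bounds for the cutoffs -/
lemma cut_bounds : ∃ K1 : ℝ, 1 ≤ K1 ∧ ∀ L, 1 ≤ L → ∀ (i j : Fin 2) (x : E2),
    |D i (fun y => th L y ^ 8) x| ≤ K1 * (th L x ^ 7 * (L⁻¹ * ei x)) ∧
    |D i (D j (fun y => th L y ^ 8)) x| ≤ K1 * (th L x ^ 6 * (L⁻¹ * ei x * ei x)) ∧
    |D i (fun y => th L y ^ 6 * (L⁻¹ * ei y)) x| ≤ K1 * (th L x ^ 5 * (L⁻¹ * ei x * ei x)) ∧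
    |D i (fun y => th L y ^ 2) x| ≤ K1 * (th L x * (L⁻¹ * ei x)) := by
  obtain ⟨B, hB, h1, h2⟩ := sg_bounds
  have hBB : B ≤ B ^ 2 := by nlinarith
  refine ⟨200 * B ^ 2, by nlinarith, ?_⟩
  intro L hL i j x
  have hL0 : 0 < L⁻¹ := by positivity
  have hL1 : L⁻¹ ≤ 1 := inv_le_one_of_one_le₀ hL
  have e0 := ei_pos x
  have ct := th_contDiff L
  have dt := diff_of (c1_of_c2 ct)
  have de := diff_of ei_contDiff
  obtain ⟨bi, bij⟩ := th_bounds hB h1 h2 hL i j x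
  have bj := (th_bounds hB h1 h2 hL j j x).1
  set t := th L x with ht
  have t0 : 0 ≤ t := th_nonneg L x
  have t1 : t ≤ 1 := th_le L x
  set g := L⁻¹ * ei x with hg
  have g0 : 0 < g := by positivity
  have ge : g ≤ ei x := by rw [hg]; nlinarith
  have hDη : ∀ j y, D j (fun y => th L y ^ 8) y = 8 * (th L y ^ 7 * D j (th L) y) := by
    intro j y; rw [D_pow dt]; push_cast; ring
  refine ⟨?_, ?_, ?_, ?_⟩
  · rw [hDη, abs_mul, abs_mul, abs_of_nonneg (pow_nonneg (th_nonneg L x) 7), ← ht]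
    have q : |(8:ℝ)| = 8 := by norm_num
    rw [q]
    calc 8 * (t ^ 7 * |D i (th L) x|) ≤ 8 * (t ^ 7 * (B * g)) := by gcongr
      _ = 8 * B * (t ^ 7 * g) := by ring
      _ ≤ 200 * B ^ 2 * (t ^ 7 * g) := by apply mul_le_mul_of_nonneg_right _ (by positivity); linarith
  · have e : D j (fun y => th L y ^ 8) = fun y => 8 * (th L y ^ 7 * D j (th L) y) := funext (hDη j)
    have dD := diff_of (D_contDiff ct j)
    have d7 : Differentiable ℝ (fun y => th L y ^ 7) := dt.pow 7
    have dm : Differentiable ℝ (fun y => th L y ^ 7 * D j (th L) y) := d7.mul dD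
    rw [e, D_const_mul dm, D_mul d7 dD, D_pow dt, ← ht]
    have q1 : |t ^ 7 * D i (D j (th L)) x| ≤ t ^ 6 * (4 * B * (g * ei x)) := by
      rw [abs_mul, abs_of_nonneg (pow_nonneg t0 7)]
      have : t ^ 7 ≤ t ^ 6 := pow_le_pow_of_le_one t0 t1 (by norm_num)
      gcongr
    have q2 : |((7:ℕ):ℝ) * t ^ (7 - 1) * D i (th L) x * D j (th L) x| ≤ 7 * (t ^ 6 * (B ^ 2 * (g * ei x))) := by
      rw [abs_mul, abs_mul, abs_of_nonneg (by positivity : 0 ≤ ((7:ℕ):ℝ) * t ^ (7 - 1))]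
      have q3 : |D i (th L) x| * |D j (th L) x| ≤ (B * g) * (B * g) := by gcongr
      have q4 : (B * g) * (B * g) ≤ B ^ 2 * (g * ei x) := by
        have : g * g ≤ g * ei x := by gcongr
        nlinarith [sq_nonneg B]
      have q5 := mul_le_mul_of_nonneg_left (q3.trans q4) (by positivity : 0 ≤ 7 * t ^ 6)
      have : (7:ℕ) - 1 = 6 := rfl
      rw [this]; push_cast
      linarith
    rw [abs_mul]
    have q : |(8:ℝ)| = 8 := by norm_num
    rw [q]
    have q6 := abs_add_le (t ^ 7 * D i (D j (th L)) x) (((7:ℕ):ℝ) * t ^ (7 - 1) * D i (th L) x * D j (th L) x)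
    have q7 : t ^ 6 * (4 * B * (g * ei x)) ≤ t ^ 6 * (4 * B ^ 2 * (g * ei x)) := by gcongr
    have q8 : 0 ≤ B ^ 2 * (t ^ 6 * (g * ei x)) := by positivity
    linarith
  · have d6 : Differentiable ℝ (fun y => th L y ^ 6) := dt.pow 6
    have dg : Differentiable ℝ (fun y => L⁻¹ * ei y) := de.const_mul _
    rw [D_mul d6 dg, D_const_mul de, D_ei, D_pow dt, ← ht, ← hg]
    have q1 : |t ^ 6 * (L⁻¹ * -(ei x * D i lg x))| ≤ t ^ 5 * (g * ei x) := by
      have e : t ^ 6 * (L⁻¹ * -(ei x * D i lg x)) = -(t ^ 6 * g * D i lg x) := by rw [hg]; ring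
      rw [e, abs_neg, abs_mul, abs_of_nonneg (by positivity : 0 ≤ t ^ 6 * g), mul_assoc]
      have : t ^ 6 ≤ t ^ 5 := pow_le_pow_of_le_one t0 t1 (by norm_num)
      have := D_lg_le i x
      gcongr
    have q2 : |((6:ℕ):ℝ) * t ^ (6 - 1) * D i (th L) x * g| ≤ 6 * B * (t ^ 5 * (g * ei x)) := by
      rw [abs_mul, abs_mul, abs_of_nonneg (by positivity : 0 ≤ ((6:ℕ):ℝ) * t ^ (6 - 1)), abs_of_pos g0]
      have q3 : |D i (th L) x| * g ≤ (B * g) * ei x := by gcongr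
      have q5 := mul_le_mul_of_nonneg_left q3 (by positivity : 0 ≤ 6 * t ^ 5)
      have : (6:ℕ) - 1 = 5 := rfl
      rw [this]; push_cast
      linarith
    refine (abs_add_le _ _).trans ((add_le_add q1 q2).trans ?_)
    have q8 : 0 ≤ t ^ 5 * (g * ei x) := by positivity
    nlinarith
  · rw [D_pow dt, abs_mul, ← ht]
    have e : |((2:ℕ):ℝ) * t ^ (2 - 1)| = 2 * t := by rw [abs_of_nonneg (by positivity)]; simp
    rw [e]
    calc 2 * t * |D i (th L) x| ≤ 2 * t * (B * g) := by gcongr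
      _ = 2 * B * (t * g) := by ring
      _ ≤ 200 * B ^ 2 * (t * g) := by apply mul_le_mul_of_nonneg_right _ (by positivity); linarith

lemma sq_of_abs {X K1 Y Z : ℝ} (h : |X| ≤ K1 * Y) (hZ : Y ^ 2 ≤ Z) : X ^ 2 ≤ K1 ^ 2 * Z := by
  have := pow_le_pow_left₀ (abs_nonneg _) h 2
  rw [sq_abs, mul_pow] at this
  nlinarith [sq_nonneg K1]

lemma exists_fam : ∃ (η ζ ρ r ω r2 : ℝ → E2 → ℝ) (K C : ℝ), Fam η ζ ρ r ω r2 K C := by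
  obtain ⟨K1, hK1, hb⟩ := cut_bounds
  have hKK : K1 ≤ K1 ^ 2 := by nlinarith
  set V := volume.real (Metric.ball (0:E2) 1) with hVd
  have hV : 0 ≤ V := measureReal_nonneg
  have hI : 0 ≤ ∫ x, ei x ^ 3 := integral_nonneg (fun x => pow_nonneg (ei_pos x).le 3)
  have ce := (ei_contDiff (n := 1)).continuous
  have hg : ∀ L : ℝ, 1 ≤ L → ∀ x, 0 < L⁻¹ * ei x ∧ L⁻¹ * ei x ≤ ei x ∧ L⁻¹ * ei x ≤ 1 := by
    intro L hL x
    have hL0 : 0 < L⁻¹ := by positivity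
    have hL1 : L⁻¹ ≤ 1 := inv_le_one_of_one_le₀ hL
    have e0 := ei_pos x
    have e1 := ei_le x
    refine ⟨by positivity, by nlinarith, by nlinarith⟩
  have hs : ∀ L : ℝ, 1 ≤ L → ∀ n : ℕ, n ≠ 0 → HasCompactSupport (fun x => th L x ^ n) := by
    intro L hL n hn
    exact (th_hcs hL).comp_left (g := fun t => t ^ n) (by simp [hn])
  have iρ : ∀ L : ℝ, 1 ≤ L → ∫ x, th L x ^ 4 * (L⁻¹ * ei x) ^ 2 ≤ 5 * V / L := by
    intro L hL
    refine le_trans ?_ (rr2_le hL)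
    apply integral_mono
    · have := (th_contDiff L).continuous
      exact Continuous.integrable_of_hasCompactSupport (by fun_prop) (hs L hL 4 (by norm_num)).mul_right
    · exact rr2_int L
    · intro x
      by_cases hx : x ∈ Metric.closedBall (0:E2) (Real.exp (2 * L))
      · simp only [rr2]; rw [Set.indicator_of_mem hx]
        have : th L x ^ 4 ≤ 1 := pow_le_one₀ (th_nonneg L x) (th_le L x)
        nlinarith [sq_nonneg (L⁻¹ * ei x)]
      · simp only [rr2]; rw [Set.indicator_of_notMem hx, th_zero hL hx]; simp
  have C1 : ∀ L : ℝ, 1 ≤ L → 5 * V / L ≤ (5 * V + ∫ x, ei x ^ 3) / L := by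
    intro L hL; gcongr; linarith
  refine ⟨fun L x => th L x ^ 8, fun L x => th L x ^ 6 * (L⁻¹ * ei x), fun L x => th L x ^ 4 * (L⁻¹ * ei x) ^ 2,
    fun L x => L⁻¹ * ei x ^ 3, fun L x => th L x ^ 2, rr2, K1 ^ 2, 5 * V + ∫ x, ei x ^ 3, ?_⟩
  refine
    { hC := by positivity, cut := ?_, ir := ?_, dζ := ?_, cρ := ?_, sρ := ?_, pρ := ?_, hρ := ?_, hρ2 := ?_,
      iρ := ?_, cω := ?_, sω := ?_, pω := ?_, dω := ?_, pr2 := fun L _ => rr2_nonneg L, ir2 := fun L _ => rr2_int L,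
      ir2' := fun L hL => (rr2_le hL).trans (C1 L hL), ωη := ?_, mono := ?_, pos := ?_ }
  · intro L hL
    refine
      { hK := by positivity, cη := (th_contDiff L).pow 8, sη := hs L hL 8 (by norm_num),
        pη := fun x => pow_nonneg (th_nonneg L x) 8,
        cζ := ((c1_of_c2 (th_contDiff L)).pow 6).mul (contDiff_const.mul ei_contDiff),
        sζ := (hs L hL 6 (by norm_num)).mul_right,
        pζ := fun x => mul_nonneg (pow_nonneg (th_nonneg L x) 6) (hg L hL x).1.le,
        pr := ?_, ir := ei3_int.const_mul _, h1 := ?_, h2 := ?_, h3 := ?_, h4 := ?_ }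
    · intro x; have := ei_pos x; positivity
    all_goals
      first | intro i j x | (intro i x; have j := i)
      obtain ⟨b1, b2, b3, b4⟩ := hb L hL i j x
      obtain ⟨g0, ge, g1⟩ := hg L hL x
      have e0 := ei_pos x
      have e1 := ei_le x
      have t0 := th_nonneg L x
      have t1 := th_le L x
    · rw [mul_assoc]; apply sq_of_abs b1
      have e : th L x ^ 8 * (th L x ^ 6 * (L⁻¹ * ei x)) = th L x ^ 14 * (1 * (L⁻¹ * ei x)) := by ring
      have e' : (th L x ^ 7 * (L⁻¹ * ei x)) ^ 2 = th L x ^ 14 * ((L⁻¹ * ei x) * (L⁻¹ * ei x)) := by ring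
      rw [e, e']; gcongr
    · refine b1.trans ?_
      have : th L x ^ 7 ≤ th L x ^ 6 := pow_le_pow_of_le_one t0 t1 (by norm_num)
      gcongr
    · rw [mul_assoc]; apply sq_of_abs b2
      have e : th L x ^ 8 * (L⁻¹ * ei x ^ 3) = th L x ^ 8 * (1 * (L⁻¹ * ei x) * ei x ^ 2) := by ring
      have e' : (th L x ^ 6 * (L⁻¹ * ei x * ei x)) ^ 2 = th L x ^ 12 * ((L⁻¹ * ei x) * (L⁻¹ * ei x) * ei x ^ 2) := by ring
      have : th L x ^ 12 ≤ th L x ^ 8 := pow_le_pow_of_le_one t0 t1 (by norm_num)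
      rw [e, e']; gcongr
    · rw [mul_assoc]; apply sq_of_abs b2
      have e : th L x ^ 6 * (L⁻¹ * ei x) * (L⁻¹ * ei x ^ 3) = th L x ^ 6 * ((L⁻¹ * ei x) * (L⁻¹ * ei x) * ei x ^ 2) := by ring
      have e' : (th L x ^ 6 * (L⁻¹ * ei x * ei x)) ^ 2 = th L x ^ 12 * ((L⁻¹ * ei x) * (L⁻¹ * ei x) * ei x ^ 2) := by ring
      have : th L x ^ 12 ≤ th L x ^ 6 := pow_le_pow_of_le_one t0 t1 (by norm_num)
      rw [e, e']; gcongr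
  · intro L hL
    have hL0 : 0 < L := by linarith
    rw [integral_const_mul, inv_mul_eq_div]; gcongr; linarith
  · intro L hL i x
    obtain ⟨b1, b2, b3, b4⟩ := hb L hL i i x
    obtain ⟨g0, ge, g1⟩ := hg L hL x
    have e0 := ei_pos x
    have t0 := th_nonneg L x
    have t1 := th_le L x
    rw [mul_assoc]; apply sq_of_abs b3
    have e : th L x ^ 6 * (L⁻¹ * ei x) * (L⁻¹ * ei x ^ 3) = th L x ^ 6 * ((L⁻¹ * ei x) * (L⁻¹ * ei x) * ei x ^ 2) := by ring
    have e' : (th L x ^ 5 * (L⁻¹ * ei x * ei x)) ^ 2 = th L x ^ 10 * ((L⁻¹ * ei x) * (L⁻¹ * ei x) * ei x ^ 2) := by ring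
    have : th L x ^ 10 ≤ th L x ^ 6 := pow_le_pow_of_le_one t0 t1 (by norm_num)
    rw [e, e']; gcongr
  · intro L hL
    have := (th_contDiff L).continuous
    fun_prop
  · intro L hL; exact (hs L hL 4 (by norm_num)).mul_right
  · intro L hL x; have := th_nonneg L x; positivity
  · intro L hL x; apply le_of_eq; ring
  · intro L hL x
    obtain ⟨g0, ge, g1⟩ := hg L hL x
    have e0 := ei_pos x
    have t0 := th_nonneg L x
    have t1 := th_le L x
    have e : th L x ^ 6 * (L⁻¹ * ei x) * (L⁻¹ * ei x ^ 3) = th L x ^ 6 * ((L⁻¹ * ei x) ^ 2 * ei x ^ 2) := by ring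
    have e' : (th L x ^ 4 * (L⁻¹ * ei x) ^ 2) ^ 2 = th L x ^ 8 * ((L⁻¹ * ei x) ^ 2 * (L⁻¹ * ei x) ^ 2) := by ring
    have : th L x ^ 8 ≤ th L x ^ 6 := pow_le_pow_of_le_one t0 t1 (by norm_num)
    rw [e, e']; gcongr
  · intro L hL; exact (iρ L hL).trans (C1 L hL)
  · intro L hL; exact (c1_of_c2 (th_contDiff L)).pow 2
  · intro L hL; exact hs L hL 2 (by norm_num)
  · intro L hL x; exact sq_nonneg _
  · intro L hL i x
    obtain ⟨b1, b2, b3, b4⟩ := hb L hL i i x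
    rw [mul_assoc]; apply sq_of_abs b4
    by_cases hx : x ∈ Metric.closedBall (0:E2) (Real.exp (2 * L))
    · unfold rr2; rw [Set.indicator_of_mem hx]; apply le_of_eq; ring
    · rw [th_zero hL hx]; simp
  · intro L hL L' h x
    rcases th_mono hL h x with h0 | h0
    · simp [h0]
    · simp only [h0]
      have t0 := th_nonneg L x
      have t1 := th_le L x
      have : th L x ^ 2 ≤ 1 := pow_le_one₀ t0 t1
      nlinarith [sq_nonneg (th L x)]
  · intro L hL L' h x
    rcases th_mono hL h x with h0 | h0
    · simp only [h0]; nlinarith [sq_nonneg (th L' x)]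
    · simp only [h0]
      have : th L x ^ 2 ≤ 1 := pow_le_one₀ (th_nonneg L x) (th_le L x)
      linarith
  · intro x
    refine ⟨max 1 (lg x), le_max_left _ _, ?_⟩
    have : th (max 1 (lg x)) x = 1 := by
      apply sg_one
      rw [inv_mul_eq_div, div_le_one (lt_of_lt_of_le one_pos (le_max_left _ _))]
      exact le_max_right _ _
    simp only [this]; norm_num

end LPE

/-- Liouville theorem for bounded weak solutions of the 2D stationary
generalized Navier–Stokes system for Prandtl–Eyring fluids, h(t) = t·ln(1+t). -/
theorem liouville_prandtl_eyring_bounded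
    (u : EuclideanSpace ℝ (Fin 2) → EuclideanSpace ℝ (Fin 2))
    (hu : ContDiff ℝ 1 u)
    (hdiv : ∀ x, divg u x = 0)
    (hweak : IsWeakSolution (fun t : ℝ => t * Real.log (1 + t)) u)
    (hbdd : ∃ M : ℝ, ∀ x, ‖u x‖ ≤ M) :
    ∃ c, ∀ x, u x = c := by
  obtain ⟨M₀, hM₀⟩ := hbdd
  have hud : Differentiable ℝ u := hu.differentiable one_ne_zero
  have ha : ContDiff ℝ 1 (fun y => u y 0) := contDiff_euclidean.1 hu 0
  have hb : ContDiff ℝ 1 (fun y => u y 1) := contDiff_euclidean.1 hu 1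
  have hd : ∀ x, LPE.D 0 (fun y => u y 0) x + LPE.D 1 (fun y => u y 1) x = 0 := by
    intro x
    have := hdiv x
    simpa only [divg, Fin.sum_univ_two, LPE.pd_eq hud] using this
  obtain ⟨ψ, hψ, h1, h0⟩ := LPE.exists_stream ha hb hd
  have bd : ∀ i x, |u x i| ≤ max 1 M₀ := fun i x =>
    (PiLp.norm_apply_le (u x) i).trans ((hM₀ x).trans (le_max_right _ _))
  have S : LPE.Sol (fun y => u y 0) (fun y => u y 1) ψ (max 1 M₀) :=
    { ha := ha, hb := hb, hψ := hψ, hd := hd, h1 := h1, h0 := h0, hM := le_max_left _ _,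
      aM := bd 0, bM := bd 1
      weak := fun ξ hξ hs => LPE.weak_C2 (LPE.FW_cont ha hb) (LPE.GW_cont ha hb)
        (fun ξ h hs => LPE.weak_smooth hu hdiv hweak h hs) hξ hs }
  obtain ⟨η, ζ, ρ, r, ω, r2, K, C, F⟩ := LPE.exists_fam
  have g0 := LPE.grad_zero S F
  refine ⟨u 0, fun x => ?_⟩
  have := LPE.const_of_gr ha hb g0 x
  ext i
  fin_cases i
  · exact this.1
  · exact this.2
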